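/- arXiv:1511.06071 — 2 statements merged into one kernel-verified Lean document; each statement's English description precedes it below -/
import Mathlib

section
/- Achievability (direct part) of the Wyner–Ahlswede–Körner theorem: Let X, Y be finite alphabets, P_XY a joint pmf on X × Y, U a finite set, and W(u|y) a conditional pmf from Y to U; give (X,Y,U) the joint pmf P(x,y)·W(u|y). Then for every δ > 0 and ε > 0 and all sufficiently large n there exist a finite set M with |M| ≤ 2^{n(H(X|U)+δ)}, a finite set L with |L| ≤ 2^{n(I(U;Y)+δ)}, an encoder f : X^n → M, a helper map g : Y^n → L, and a decoder D : M × L → X^n such that the n-fold product pmf P_XY^{⊗n} assigns probability at most ε to the set {(x^n,y^n) : D(f(x^n), g(y^n)) ≠ x^n}. -/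
open scoped BigOperators

/-- Shannon entropy (base 2) of a pmf on a finite set. -/
noncomputable def shEnt {S : Type*} [Fintype S] (p : S → ℝ) : ℝ :=
  ∑ s, -(p s * Real.logb 2 (p s))

/-- Conditional Shannon entropy `H(X|U)` computed from a joint pmf on `X × U`. -/
noncomputable def condEnt {X U : Type*} [Fintype X] [Fintype U] (P : X × U → ℝ) : ℝ :=
  shEnt P - shEnt (fun u => ∑ x, P (x, u))

/-- Mutual information `I(X;U)` computed from a joint pmf on `X × U`. -/
noncomputable def mutInfo {X U : Type*} [Fintype X] [Fintype U] (P : X × U → ℝ) : ℝ :=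
  shEnt (fun x => ∑ u, P (x, u)) + shEnt (fun u => ∑ x, P (x, u)) - shEnt P


namespace WAK

open Finset

open Classical in
lemma card_eq_pair {A M : Type} [Fintype A] [Fintype M] (a a' : A) (h : a' ≠ a) :
    ((univ.filter (fun f : A → M => f a' = f a)).card : ℝ) * Fintype.card M
      ≤ Fintype.card (A → M) := by
  have : ((univ.filter (fun f : A → M => f a' = f a)) ×ˢ (univ : Finset M)).card
      ≤ (univ : Finset (A → M)).card := by
    apply Finset.card_le_card_of_injOn (fun z => Function.update z.1 a' z.2)
    · intro z _; simp
    · rintro ⟨f, m⟩ hf ⟨f', m'⟩ hf' heq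
      simp only [coe_product, coe_filter, mem_univ, true_and, coe_univ, Set.mem_prod,
        Set.mem_ofPred_eq, Set.mem_univ, and_true] at hf hf'
      simp only at heq
      have e1 : ∀ i, i ≠ a' → f i = f' i := by
        intro i hi
        have := congrFun heq i
        simpa [Function.update_of_ne hi] using this
      have e2 : m = m' := by simpa using congrFun heq a'
      have e3 : f = f' := by
        funext i
        by_cases hi : i = a'
        · subst hi; rw [hf, hf']; exact e1 a h.symm
        · exact e1 i hi
      rw [e2, e3]
  rw [card_product] at this
  simp only [card_univ] at this
  exact_mod_cast this

open Classical in
lemma binning {A B M : Type} [Fintype A] [Fintype B] [Fintype M] [Nonempty M]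
    (p : A → B → ℝ) (hp : ∀ a b, 0 ≤ p a b) (hp1 : ∑ a, ∑ b, p a b = 1)
    (S : B → A → Prop) (R : ℝ) (hR : ∀ b, ((univ.filter (S b)).card : ℝ) ≤ R) :
    ∃ f : A → M, ∑ a, ∑ b, p a b * (if ∃ a', a' ≠ a ∧ S b a' ∧ f a' = f a then 1 else 0)
      ≤ R / Fintype.card M := by
  have hM : (0 : ℝ) < Fintype.card M := by exact_mod_cast Fintype.card_pos
  have key : ∑ f : A → M, (∑ a, ∑ b, p a b *
      (if ∃ a', a' ≠ a ∧ S b a' ∧ f a' = f a then (1 : ℝ) else 0))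
      ≤ ∑ f : A → M, R / Fintype.card M := by
    have inner : ∀ a b, ∑ f : A → M,
        (if ∃ a', a' ≠ a ∧ S b a' ∧ f a' = f a then (1 : ℝ) else 0)
        ≤ Fintype.card (A → M) * (R / Fintype.card M) := by
      intro a b
      calc ∑ f : A → M, (if ∃ a', a' ≠ a ∧ S b a' ∧ f a' = f a then (1 : ℝ) else 0)
          ≤ ∑ f : A → M, ∑ a' ∈ univ.filter (S b),
            (if a' ≠ a ∧ f a' = f a then (1 : ℝ) else 0) := by
            apply sum_le_sum
            intro f _
            split_ifs with h
            · obtain ⟨a', h1, h2, h3⟩ := h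
              have := Finset.single_le_sum
                (f := fun a' => if a' ≠ a ∧ f a' = f a then (1 : ℝ) else 0)
                (s := univ.filter (S b))
                (fun i _ => by split_ifs <;> norm_num) (a := a') (by simp [h2])
              simpa [h1, h3] using this
            · exact sum_nonneg (fun i _ => by split_ifs <;> norm_num)
        _ = ∑ a' ∈ univ.filter (S b), ∑ f : A → M,
            (if a' ≠ a ∧ f a' = f a then (1 : ℝ) else 0) := sum_comm
        _ ≤ ∑ a' ∈ univ.filter (S b), (Fintype.card (A → M) : ℝ) / Fintype.card M := by
            apply sum_le_sum
            intro a' _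
            by_cases h : a' = a
            · simp only [h, ne_eq, not_true_eq_false, false_and, if_false, sum_const_zero]
              positivity
            · rw [le_div_iff₀ hM]
              refine le_trans (le_of_eq ?_) (card_eq_pair (M := M) a a' h)
              simp [h]
        _ ≤ _ := by
            rw [sum_const, nsmul_eq_mul]
            have := hR b
            calc ((univ.filter (S b)).card : ℝ) * ((Fintype.card (A → M) : ℝ) / Fintype.card M)
                ≤ R * ((Fintype.card (A → M) : ℝ) / Fintype.card M) := by gcongr
              _ = _ := by ring
    calc _ = ∑ a, ∑ b, p a b * ∑ f : A → M,
        (if ∃ a', a' ≠ a ∧ S b a' ∧ f a' = f a then (1 : ℝ) else 0) := by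
          rw [sum_comm]
          refine sum_congr rfl fun a _ => ?_
          rw [sum_comm]
          refine sum_congr rfl fun b _ => ?_
          rw [mul_sum]
      _ ≤ ∑ a, ∑ b, p a b * (Fintype.card (A → M) * (R / Fintype.card M)) := by
          refine sum_le_sum fun a _ => sum_le_sum fun b _ => ?_
          exact mul_le_mul_of_nonneg_left (inner a b) (hp a b)
      _ = _ := by
          simp only [← sum_mul, hp1, sum_const, card_univ, nsmul_eq_mul, one_mul]
  obtain ⟨f, -, hf⟩ := exists_le_of_sum_le (univ_nonempty) key
  exact ⟨f, hf⟩

lemma exp_conv (s t : ℝ) (ht0 : 0 ≤ t) (ht1 : t ≤ 1) :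
    Real.exp (-(s * t)) ≤ (1 - t) + Real.exp (-s) := by
  have := convexOn_exp.2 (Set.mem_univ (0 : ℝ)) (Set.mem_univ (-s)) (sub_nonneg.2 ht1) ht0
    (by ring)
  simp only [smul_eq_mul, mul_zero, zero_add, Real.exp_zero, mul_one] at this
  have e : t * -s = -(s * t) := by ring
  rw [e] at this
  nlinarith [Real.exp_pos (-s)]

open Classical in
lemma cover0 {B C : Type} [Fintype B] [Fintype C]
    (pB : B → ℝ) (hp : ∀ b, 0 ≤ pB b) (hp1 : ∑ b, pB b = 1)
    (w : B → C → ℝ) (hw : ∀ b c, 0 ≤ w b c) (hw1 : ∀ b, ∑ c, w b c = 1)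
    (Q : C → ℝ) (hQ : ∀ c, 0 ≤ Q c) (hQ1 : ∑ c, Q c = 1)
    (S : B → C → Prop) (K : ℕ) (Γ : ℝ) (hΓ : 0 < Γ)
    (hS : ∀ b c, S b c → w b c ≤ Γ * Q c) :
    ∃ cb : Fin K → C, ∑ b, pB b * (if ∀ i, ¬ S b (cb i) then 1 else 0)
      ≤ ∑ b, ∑ c, pB b * w b c * (if ¬ S b c then 1 else 0) + Real.exp (-(K / Γ)) := by
  by_contra hcon
  push Not at hcon
  set E := ∑ b, ∑ c, pB b * w b c * (if ¬ S b c then 1 else 0) + Real.exp (-(K / Γ)) with hE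
  have wt1 : ∑ cb : Fin K → C, ∏ i, Q (cb i) = 1 := by
    have := Finset.prod_univ_sum (fun _ : Fin K => (univ : Finset C)) (fun _ c => Q c)
    simp only [hQ1, Fintype.piFinset_univ, prod_const_one] at this
    exact this.symm
  have avg : ∀ b, ∑ cb : Fin K → C, (∏ i, Q (cb i)) * (if ∀ i, ¬ S b (cb i) then (1:ℝ) else 0)
      ≤ ∑ c, w b c * (if ¬ S b c then 1 else 0) + Real.exp (-(K / Γ)) := by
    intro b
    have e1 : ∑ cb : Fin K → C, (∏ i, Q (cb i)) * (if ∀ i, ¬ S b (cb i) then (1:ℝ) else 0)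
        = (∑ c, Q c * (if ¬ S b c then 1 else 0)) ^ K := by
      have := Finset.prod_univ_sum (fun _ : Fin K => (univ : Finset C))
        (fun _ c => Q c * (if ¬ S b c then (1:ℝ) else 0))
      simp only [Fintype.piFinset_univ, prod_const, card_univ, Fintype.card_fin] at this
      rw [this]
      refine sum_congr rfl fun cb _ => ?_
      rw [prod_mul_distrib]
      congr 1
      rw [Finset.prod_ite_zero]
      simp
    set t := ∑ c, w b c * (if S b c then 1 else 0) with ht
    set q := ∑ c, Q c * (if S b c then 1 else 0) with hq
    have e2 : ∑ c, Q c * (if ¬ S b c then (1:ℝ) else 0) = 1 - q := by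
      rw [hq, eq_sub_iff_add_eq, ← sum_add_distrib]
      refine Eq.trans ?_ hQ1
      refine sum_congr rfl fun c _ => ?_
      by_cases h : S b c <;> simp [h]
    have e3 : ∑ c, w b c * (if ¬ S b c then (1:ℝ) else 0) = 1 - t := by
      rw [ht, eq_sub_iff_add_eq, ← sum_add_distrib]
      refine Eq.trans ?_ (hw1 b)
      refine sum_congr rfl fun c _ => ?_
      by_cases h : S b c <;> simp [h]
    have t0 : 0 ≤ t := sum_nonneg fun c _ => mul_nonneg (hw b c) (by split_ifs <;> norm_num)
    have t1 : t ≤ 1 := by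
      have : 0 ≤ 1 - t := by
        rw [← e3]
        exact sum_nonneg fun c _ => mul_nonneg (hw b c) (by split_ifs <;> norm_num)
      linarith
    have q1 : 0 ≤ 1 - q := by
      rw [← e2]
      exact sum_nonneg fun c _ => mul_nonneg (hQ c) (by split_ifs <;> norm_num)
    have tq : t ≤ Γ * q := by
      rw [ht, hq, mul_sum]
      refine sum_le_sum fun c _ => ?_
      by_cases h : S b c
      · simpa [h] using hS b c h
      · simp [h]
    rw [e1, e2, e3]
    calc (1 - q) ^ K ≤ (Real.exp (-q)) ^ K := by
          gcongr
          have := Real.add_one_le_exp (-q); linarith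
      _ = Real.exp (-(K * q)) := by rw [← Real.exp_nat_mul]; congr 1; ring
      _ ≤ Real.exp (-((K / Γ) * t)) := by
          apply Real.exp_le_exp.2
          apply neg_le_neg
          rw [div_mul_eq_mul_div, div_le_iff₀ hΓ]
          have : (0:ℝ) ≤ K := Nat.cast_nonneg K
          nlinarith
      _ ≤ _ := exp_conv _ _ t0 t1
  have lt : E < ∑ cb : Fin K → C, (∏ i, Q (cb i)) *
      ∑ b, pB b * (if ∀ i, ¬ S b (cb i) then (1:ℝ) else 0) := by
    have hle : ∀ cb ∈ (univ : Finset (Fin K → C)), (∏ i, Q (cb i)) * E ≤ (∏ i, Q (cb i)) *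
      ∑ b, pB b * (if ∀ i, ¬ S b (cb i) then (1:ℝ) else 0) := fun cb _ =>
        mul_le_mul_of_nonneg_left (hcon cb).le (prod_nonneg fun i _ => hQ _)
    have hex : ∃ cb : Fin K → C, 0 < ∏ i, Q (cb i) := by
      by_contra h
      push Not at h
      have := sum_nonpos (s := (univ : Finset (Fin K → C))) (fun cb _ => h cb)
      linarith
    obtain ⟨cb, hcb⟩ := hex
    have := sum_lt_sum hle ⟨cb, mem_univ _, mul_lt_mul_of_pos_left (hcon cb) hcb⟩
    rwa [← sum_mul, wt1, one_mul] at this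
  have ge : ∑ cb : Fin K → C, (∏ i, Q (cb i)) *
      ∑ b, pB b * (if ∀ i, ¬ S b (cb i) then (1:ℝ) else 0) ≤ E := by
    calc _ = ∑ b, pB b * ∑ cb : Fin K → C, (∏ i, Q (cb i)) *
          (if ∀ i, ¬ S b (cb i) then (1:ℝ) else 0) := by
          simp only [mul_sum]
          rw [sum_comm]
          refine sum_congr rfl fun b _ => sum_congr rfl fun cb _ => by ring
      _ ≤ ∑ b, pB b * (∑ c, w b c * (if ¬ S b c then 1 else 0) + Real.exp (-(K / Γ))) :=
          sum_le_sum fun b _ => mul_le_mul_of_nonneg_left (avg b) (hp b)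
      _ = E := by
          rw [hE]
          simp only [mul_add, sum_add_distrib, ← sum_mul, hp1, one_mul, mul_sum, mul_assoc]
  linarith

open Classical in
lemma cover {A B C : Type} [Fintype A] [Fintype B] [Fintype C]
    (p : A → B → ℝ) (hp : ∀ a b, 0 ≤ p a b) (hp1 : ∑ a, ∑ b, p a b = 1)
    (w : B → C → ℝ) (hw : ∀ b c, 0 ≤ w b c) (hw1 : ∀ b, ∑ c, w b c = 1)
    (Q : C → ℝ) (hQ : ∀ c, 0 ≤ Q c) (hQ1 : ∑ c, Q c = 1)
    (T : C → A → Prop) (K : ℕ) (hK : 0 < K) (Γ : ℝ) (hΓ : 0 < Γ) (η θ : ℝ) (hθ : 0 < θ)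
    (h1 : ∑ a, ∑ b, ∑ c, p a b * w b c * (if ¬ T c a then 1 else 0) ≤ η)
    (h2 : ∑ a, ∑ b, ∑ c, p a b * w b c * (if ¬ w b c ≤ Γ * Q c then 1 else 0) ≤ η) :
    ∃ (cb : Fin K → C) (g : B → Fin K),
      ∑ a, ∑ b, p a b * (if ¬ T (cb (g b)) a then 1 else 0)
      ≤ θ + (η + η / θ + Real.exp (-(K / Γ))) := by
  set pB : B → ℝ := fun b => ∑ a, p a b with hpB
  have pB0 : ∀ b, 0 ≤ pB b := fun b => sum_nonneg fun a _ => hp a b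
  have pB1 : ∑ b, pB b = 1 := by rw [← hp1, hpB, sum_comm]
  set π : B → C → ℝ := fun b c => ∑ a, p a b * (if ¬ T c a then 1 else 0) with hπ
  have π0 : ∀ b c, 0 ≤ π b c := fun b c => sum_nonneg fun a _ =>
    mul_nonneg (hp a b) (by split_ifs <;> norm_num)
  have πle : ∀ b c, π b c ≤ pB b := fun b c => sum_le_sum fun a _ => by
    split_ifs <;> simp [hp a b]
  obtain ⟨S, hSd⟩ : ∃ S : B → C → Prop, ∀ b c, S b c ↔
      (w b c ≤ Γ * Q c ∧ π b c ≤ θ * pB b) :=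
    ⟨_, fun _ _ => Iff.rfl⟩
  obtain ⟨cb, hcb⟩ := cover0 pB pB0 pB1 w hw hw1 Q hQ hQ1
    S K Γ hΓ (fun b c h => ((hSd b c).1 h).1)
  have h1' : ∑ b, ∑ c, w b c * π b c ≤ η := by
    refine le_trans (le_of_eq ?_) h1
    rw [sum_comm (s := (univ : Finset A))]
    refine sum_congr rfl fun b _ => ?_
    rw [sum_comm]
    refine sum_congr rfl fun c _ => ?_
    rw [hπ, mul_sum]
    refine sum_congr rfl fun a _ => by ring
  have h2' : ∑ b, ∑ c, pB b * w b c * (if ¬ w b c ≤ Γ * Q c then 1 else 0) ≤ η := by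
    refine le_trans (le_of_eq ?_) h2
    rw [sum_comm (s := (univ : Finset A))]
    refine sum_congr rfl fun b _ => ?_
    rw [sum_comm]
    refine sum_congr rfl fun c _ => ?_
    rw [hpB]
    simp only [sum_mul]
  have hbad : ∑ b, ∑ c, pB b * w b c *
      (if ¬ S b c then (1:ℝ) else 0) ≤ η + η / θ := by
    calc _ ≤ ∑ b, ∑ c, (pB b * w b c * (if ¬ w b c ≤ Γ * Q c then 1 else 0)
            + (w b c * π b c) / θ) := by
          refine sum_le_sum fun b _ => sum_le_sum fun c _ => ?_
          have n1 := mul_nonneg (pB0 b) (hw b c)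
          have n2 : 0 ≤ (w b c * π b c) / θ := div_nonneg (mul_nonneg (hw b c) (π0 b c)) hθ.le
          by_cases ha : w b c ≤ Γ * Q c
          · by_cases hb : π b c ≤ θ * pB b
            · simp [hSd, ha, hb, n2]
            · simp only [hSd, ha, hb, and_false, not_false_iff, if_true, not_true, if_false, mul_one,
                mul_zero, zero_add]
              rw [le_div_iff₀ hθ]
              push Not at hb
              nlinarith [mul_le_mul_of_nonneg_left hb.le (hw b c)]
          · simp only [hSd, ha, false_and, not_false_iff, if_true, mul_one]
            linarith
      _ = ∑ b, ∑ c, (pB b * w b c * (if ¬ w b c ≤ Γ * Q c then 1 else 0))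
            + (∑ b, ∑ c, w b c * π b c) / θ := by
          simp only [sum_add_distrib, sum_div]
      _ ≤ _ := add_le_add h2' (by gcongr)
  have hg : ∀ b, ∃ i : Fin K, (∃ j, S b (cb j)) →
      π b (cb i) ≤ θ * pB b := by
    intro b
    by_cases h : ∃ j, S b (cb j)
    · obtain ⟨j, hj⟩ := h
      exact ⟨j, fun _ => ((hSd _ _).1 hj).2⟩
    · exact ⟨⟨0, hK⟩, fun h' => absurd h' h⟩
  choose g hg using hg
  refine ⟨cb, g, ?_⟩
  calc ∑ a, ∑ b, p a b * (if ¬ T (cb (g b)) a then (1:ℝ) else 0)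
      = ∑ b, π b (cb (g b)) := by rw [sum_comm]
    _ ≤ ∑ b, (θ * pB b + pB b * (if ∀ i, ¬ S b (cb i)
          then 1 else 0)) := by
        refine sum_le_sum fun b _ => ?_
        have := mul_nonneg hθ.le (pB0 b)
        split_ifs with h
        · have := πle b (cb (g b)); linarith
        · push Not at h
          have := hg b h
          linarith
    _ ≤ _ := by
        rw [sum_add_distrib, ← mul_sum, pB1, mul_one]
        linarith

open Classical in
lemma oneshot {A B C : Type} [Fintype A] [Fintype B] [Fintype C] [DecidableEq A]
    (p : A → B → ℝ) (hp : ∀ a b, 0 ≤ p a b) (hp1 : ∑ a, ∑ b, p a b = 1)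
    (w : B → C → ℝ) (hw : ∀ b c, 0 ≤ w b c) (hw1 : ∀ b, ∑ c, w b c = 1)
    (Q : C → ℝ) (hQ : ∀ c, 0 ≤ Q c) (hQ1 : ∑ c, Q c = 1)
    (T : C → A → Prop) (K : ℕ) (hK : 0 < K) (M : ℕ) (hM : 0 < M)
    (Γ : ℝ) (hΓ : 0 < Γ) (η θ : ℝ) (hθ : 0 < θ)
    (R : ℝ) (hR : ∀ c, ((univ.filter (T c)).card : ℝ) ≤ R)
    (h1 : ∑ a, ∑ b, ∑ c, p a b * w b c * (if ¬ T c a then 1 else 0) ≤ η)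
    (h2 : ∑ a, ∑ b, ∑ c, p a b * w b c * (if ¬ w b c ≤ Γ * Q c then 1 else 0) ≤ η) :
    ∃ (f : A → Fin M) (g : B → Fin K) (D : Fin M × Fin K → A),
      ∑ a, ∑ b, (if D (f a, g b) ≠ a then p a b else 0)
      ≤ θ + (η + η / θ + Real.exp (-(K / Γ))) + R / M := by
  obtain ⟨cb, g, hg⟩ := cover p hp hp1 w hw hw1 Q hQ hQ1 T K hK Γ hΓ η θ hθ h1 h2
  have : Nonempty (Fin M) := ⟨⟨0, hM⟩⟩
  obtain ⟨f, hf⟩ := binning (M := Fin M) p hp hp1 (fun b => T (cb (g b))) R (fun b => hR _)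
  rw [Fintype.card_fin] at hf
  have hA : Nonempty A := by
    by_contra h
    rw [not_nonempty_iff] at h
    simp at hp1
  have hD : ∀ z : Fin M × Fin K, ∃ a : A, (∃ a', T (cb z.2) a' ∧ f a' = z.1) →
      (T (cb z.2) a ∧ f a = z.1) := by
    intro z
    by_cases h : ∃ a', T (cb z.2) a' ∧ f a' = z.1
    · obtain ⟨a, ha⟩ := h
      exact ⟨a, fun _ => ha⟩
    · exact ⟨hA.some, fun h' => absurd h' h⟩
  choose D hD using hD
  refine ⟨f, g, D, ?_⟩
  refine le_trans ?_ (add_le_add hg hf)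
  rw [← sum_add_distrib]
  refine sum_le_sum fun a _ => ?_
  rw [← sum_add_distrib]
  refine sum_le_sum fun b _ => ?_
  have := hp a b
  by_cases h : T (cb (g b)) a
  · have hd := hD (f a, g b) ⟨a, h, rfl⟩
    by_cases he : D (f a, g b) = a
    · simp only [he, ne_eq, not_true, if_false]
      split_ifs <;> simp [this]
    · have : ∃ a', a' ≠ a ∧ T (cb (g b)) a' ∧ f a' = f a := ⟨_, he, hd.1, hd.2⟩
      simp only [this, if_true, he, ne_eq, not_false_iff, h, not_true, if_false, mul_zero, zero_add,
        mul_one, le_refl]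
  · simp only [h, not_false_iff, if_true, mul_one]
    split_ifs <;> simp [this]

end WAK

namespace WAK

open Finset

lemma exists_mgf_lt {Z : Type} [Fintype Z] (r ψ : Z → ℝ) (hr1 : ∑ z, r z = 1)
    (hneg : ∑ z, r z * ψ z < 0) : ∃ s : ℝ, 0 < s ∧ ∑ z, r z * Real.exp (s * ψ z) < 1 := by
  have hd : HasDerivAt (fun s : ℝ => ∑ z, r z * Real.exp (s * ψ z)) (∑ z, r z * ψ z) 0 := by
    apply HasDerivAt.fun_sum
    intro z _
    have h1 : HasDerivAt (fun s : ℝ => s * ψ z) (ψ z) 0 := by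
      simpa using (hasDerivAt_id (0:ℝ)).mul_const (ψ z)
    have h2 := (h1.exp).const_mul (r z)
    simpa using h2
  have h3 := hasDerivAt_iff_tendsto_slope.1 hd
  have h4 : ∀ᶠ s in nhdsWithin (0:ℝ) {0}ᶜ,
      slope (fun s : ℝ => ∑ z, r z * Real.exp (s * ψ z)) 0 s < 0 :=
    h3.eventually (gt_mem_nhds hneg)
  have h5 : ∀ᶠ s in nhdsWithin (0:ℝ) (Set.Ioi 0),
      slope (fun s : ℝ => ∑ z, r z * Real.exp (s * ψ z)) 0 s < 0 :=
    h4.filter_mono (nhdsWithin_mono _ (by intro x hx; simpa using (ne_of_gt hx)))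
  obtain ⟨s, hs, hs0⟩ := (h5.and self_mem_nhdsWithin).exists
  refine ⟨s, hs0, ?_⟩
  rw [slope_def_field] at hs
  simp only [zero_mul, Real.exp_zero, mul_one, hr1, sub_zero] at hs
  have hs0' : 0 < s := hs0
  rw [div_lt_iff₀ hs0'] at hs
  linarith

open Classical in
lemma chernoff {Z : Type} [Fintype Z] (r φ : Z → ℝ) (hr : ∀ z, 0 ≤ r z) (hr1 : ∑ z, r z = 1)
    (δ ε : ℝ) (hδ : 0 < δ) (hε : 0 < ε) :
    ∃ N : ℕ, ∀ n, N ≤ n → ∑ z : Fin n → Z, (∏ t, r (z t)) *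
      (if (n : ℝ) * (∑ z, r z * φ z + δ) < ∑ t, φ (z t) then 1 else 0) ≤ ε := by
  set μ := ∑ z, r z * φ z with hμ
  obtain ⟨s, hs, hlt⟩ := exists_mgf_lt r (fun z => φ z - μ - δ) hr1 (by
    have : ∑ z, r z * (φ z - μ - δ) = -δ := by
      simp only [mul_sub, sum_sub_distrib, ← sum_mul, hr1, ← hμ]; ring
    rw [this]; linarith)
  set h := ∑ z, r z * Real.exp (s * (φ z - μ - δ)) with hh
  have h0 : 0 ≤ h := sum_nonneg fun z _ => mul_nonneg (hr z) (Real.exp_pos _).le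
  have ht := tendsto_pow_atTop_nhds_zero_of_lt_one h0 hlt
  obtain ⟨N, hN⟩ := Filter.eventually_atTop.1 (ht.eventually (gt_mem_nhds hε))
  refine ⟨N, fun n hn => le_trans ?_ (hN n hn).le⟩
  have e := Finset.prod_univ_sum (fun _ : Fin n => (univ : Finset Z))
        (fun _ z => r z * Real.exp (s * (φ z - μ - δ)))
  simp only [Fintype.piFinset_univ, prod_const, card_univ, Fintype.card_fin] at e
  rw [hh, e]
  refine sum_le_sum fun z _ => ?_
  rw [prod_mul_distrib]
  refine mul_le_mul_of_nonneg_left ?_ (prod_nonneg fun t _ => hr _)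
  rw [← Real.exp_sum]
  split_ifs with hc
  · apply Real.one_le_exp
    rw [← mul_sum]
    apply mul_nonneg hs.le
    simp only [sum_sub_distrib, sum_const, card_univ, Fintype.card_fin, nsmul_eq_mul]
    linarith
  · exact (Real.exp_pos _).le

lemma sum_triple {X Y U : Type} [Fintype X] [Fintype Y] [Fintype U] (n : ℕ)
    (F : (Fin n → X) → (Fin n → Y) → (Fin n → U) → ℝ) :
    ∑ z : Fin n → X × Y × U, F (fun t => (z t).1) (fun t => (z t).2.1) (fun t => (z t).2.2)
      = ∑ a, ∑ b, ∑ c, F a b c := by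
  let e : (Fin n → X × Y × U) ≃ (Fin n → X) × (Fin n → Y) × (Fin n → U) :=
    { toFun := fun z => (fun t => (z t).1, fun t => (z t).2.1, fun t => (z t).2.2)
      invFun := fun q t => (q.1 t, q.2.1 t, q.2.2 t)
      left_inv := fun z => rfl
      right_inv := fun q => rfl }
  have h := Equiv.sum_comp e (fun q => F q.1 q.2.1 q.2.2)
  simp only [Fintype.sum_prod_type] at h
  exact h

open Classical in
lemma chernoff3 {X Y U : Type} [Fintype X] [Fintype Y] [Fintype U]
    (P : X × Y → ℝ) (hP0 : ∀ z, 0 ≤ P z) (hP1 : ∑ z, P z = 1)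
    (W : Y → U → ℝ) (hW0 : ∀ y u, 0 ≤ W y u) (hW1 : ∀ y, ∑ u, W y u = 1)
    (φ : X → Y → U → ℝ) (μ : ℝ) (hμ : ∑ x, ∑ y, ∑ u, P (x, y) * W y u * φ x y u = μ)
    (δ ε : ℝ) (hδ : 0 < δ) (hε : 0 < ε) :
    ∃ N : ℕ, ∀ n, N ≤ n → ∀ B : (Fin n → X) → (Fin n → Y) → (Fin n → U) → Prop,
      (∀ a b c, (∀ t, 0 < P (a t, b t)) → (∀ t, 0 < W (b t) (c t)) → B a b c →
        (n : ℝ) * (μ + δ) < ∑ t, φ (a t) (b t) (c t)) →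
      ∑ a : Fin n → X, ∑ b : Fin n → Y, ∑ c : Fin n → U,
        (∏ t, P (a t, b t)) * (∏ t, W (b t) (c t)) * (if B a b c then 1 else 0) ≤ ε := by
  obtain ⟨N, hN⟩ := chernoff (fun z : X × Y × U => P (z.1, z.2.1) * W z.2.1 z.2.2)
    (fun z => φ z.1 z.2.1 z.2.2) (fun z => mul_nonneg (hP0 _) (hW0 _ _)) (by
      simp only [Fintype.sum_prod_type, ← mul_sum, hW1, mul_one]
      rw [← hP1, Fintype.sum_prod_type]) δ ε hδ hε
  refine ⟨N, fun n hn B hB => le_trans ?_ (hN n hn)⟩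
  have hμ' : ∑ z : X × Y × U, P (z.1, z.2.1) * W z.2.1 z.2.2 * φ z.1 z.2.1 z.2.2 = μ := by
    simp only [Fintype.sum_prod_type]; exact hμ
  rw [hμ']
  rw [← sum_triple n (fun a b c =>
    (∏ t, P (a t, b t)) * (∏ t, W (b t) (c t)) * (if B a b c then 1 else 0))]
  refine sum_le_sum fun z _ => ?_
  rw [prod_mul_distrib]
  by_cases h1 : ∀ t, 0 < P ((z t).1, (z t).2.1)
  · by_cases h2 : ∀ t, 0 < W (z t).2.1 (z t).2.2
    · refine mul_le_mul_of_nonneg_left ?_ (mul_nonneg (prod_nonneg fun t _ => hP0 _)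
        (prod_nonneg fun t _ => hW0 _ _))
      by_cases h3 : B (fun t => (z t).1) (fun t => (z t).2.1) (fun t => (z t).2.2)
      · rw [if_pos h3, if_pos (hB _ _ _ h1 h2 h3)]
      · rw [if_neg h3]; split_ifs <;> norm_num
    · push Not at h2
      obtain ⟨t, ht⟩ := h2
      have : ∏ t, W (z t).2.1 (z t).2.2 = 0 :=
        prod_eq_zero (mem_univ t) (le_antisymm ht (hW0 _ _))
      simp [this]
  · push Not at h1
    obtain ⟨t, ht⟩ := h1
    have : ∏ t, P ((z t).1, (z t).2.1) = 0 :=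
      prod_eq_zero (mem_univ t) (le_antisymm ht (hP0 _))
    simp [this]

/-- conditional entropy as an expectation -/
lemma condEnt_eq {X U : Type} [Fintype X] [Fintype U] (J : X × U → ℝ) (hJ : ∀ z, 0 ≤ J z) :
    condEnt J = ∑ x, ∑ u, J (x, u) * -Real.logb 2 (J (x, u) / ∑ x', J (x', u)) := by
  unfold condEnt shEnt
  rw [Fintype.sum_prod_type]
  have : ∑ u, -((∑ x, J (x, u)) * Real.logb 2 (∑ x, J (x, u)))
      = ∑ x, ∑ u, -(J (x, u) * Real.logb 2 (∑ x', J (x', u))) := by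
    rw [sum_comm]
    refine sum_congr rfl fun u _ => ?_
    rw [sum_mul, ← sum_neg_distrib]
  rw [this, ← sum_sub_distrib]
  refine sum_congr rfl fun x _ => ?_
  rw [← sum_sub_distrib]
  refine sum_congr rfl fun u _ => ?_
  rcases (hJ (x, u)).eq_or_lt with h | h
  · simp [← h]
  · have h2 : 0 < ∑ x', J (x', u) := lt_of_lt_of_le h
      (single_le_sum (f := fun x' => J (x', u)) (fun i _ => hJ _) (mem_univ x))
    rw [Real.logb_div h.ne' h2.ne']
    ring

lemma condEnt_nonneg {X U : Type} [Fintype X] [Fintype U] (J : X × U → ℝ) (hJ : ∀ z, 0 ≤ J z) :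
    0 ≤ condEnt J := by
  rw [condEnt_eq J hJ]
  refine sum_nonneg fun x _ => sum_nonneg fun u _ => mul_nonneg (hJ _) ?_
  rw [neg_nonneg]
  have h2 : J (x, u) ≤ ∑ x', J (x', u) :=
      (single_le_sum (f := fun x' => J (x', u)) (fun i _ => hJ _) (mem_univ x))
  apply Real.logb_nonpos (by norm_num)
  · exact div_nonneg (hJ _) ((hJ _).trans h2)
  · exact div_le_one_of_le₀ h2 ((hJ _).trans h2)

lemma mutInfo_eq {Y U : Type} [Fintype Y] [Fintype U] (p : Y → ℝ) (hp : ∀ y, 0 ≤ p y)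
    (W : Y → U → ℝ) (hW0 : ∀ y u, 0 ≤ W y u) (hW1 : ∀ y, ∑ u, W y u = 1) :
    mutInfo (fun z : U × Y => p z.2 * W z.2 z.1) =
      ∑ y, ∑ u, p y * W y u * Real.logb 2 (W y u / ∑ y', p y' * W y' u) := by
  unfold mutInfo shEnt
  rw [Fintype.sum_prod_type_right]
  have e1 : ∑ u, -((∑ y, p y * W y u) * Real.logb 2 (∑ y, p y * W y u))
      = ∑ y, ∑ u, -(p y * W y u * Real.logb 2 (∑ y, p y * W y u)) := by
    rw [sum_comm]
    refine sum_congr rfl fun u _ => ?_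
    rw [sum_mul, ← sum_neg_distrib]
  have e2 : ∑ y, -((∑ u, p y * W y u) * Real.logb 2 (∑ u, p y * W y u))
      = ∑ y, ∑ u, -(p y * W y u * Real.logb 2 (p y)) := by
    refine sum_congr rfl fun y _ => ?_
    rw [← mul_sum, hW1, mul_one, sum_neg_distrib, ← sum_mul, ← mul_sum, hW1, mul_one]
  simp only
  rw [e1, e2, ← sum_add_distrib, ← sum_sub_distrib]
  refine sum_congr rfl fun y _ => ?_
  rw [← sum_add_distrib, ← sum_sub_distrib]
  refine sum_congr rfl fun u _ => ?_
  rcases (hp y).eq_or_lt with h | h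
  · simp [← h]
  rcases (hW0 y u).eq_or_lt with h' | h'
  · simp [← h']
  have hh := mul_pos h h'
  have h2 : 0 < ∑ y', p y' * W y' u := lt_of_lt_of_le hh
    (single_le_sum (f := fun y' => p y' * W y' u)
      (fun i _ => mul_nonneg (hp _) (hW0 _ _)) (mem_univ y))
  rw [Real.logb_div h'.ne' h2.ne', Real.logb_mul h.ne' h'.ne']
  ring

lemma mutInfo_nonneg {Y U : Type} [Fintype Y] [Fintype U] (p : Y → ℝ) (hp : ∀ y, 0 ≤ p y)
    (hp1 : ∑ y, p y = 1)
    (W : Y → U → ℝ) (hW0 : ∀ y u, 0 ≤ W y u) (hW1 : ∀ y, ∑ u, W y u = 1) :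
    0 ≤ mutInfo (fun z : U × Y => p z.2 * W z.2 z.1) := by
  rw [mutInfo_eq p hp W hW0 hW1]
  have hl : 0 < Real.log 2 := Real.log_pos (by norm_num)
  have key : ∀ y u, (p y * W y u - p y * ∑ y', p y' * W y' u) / Real.log 2
      ≤ p y * W y u * Real.logb 2 (W y u / ∑ y', p y' * W y' u) := by
    intro y u
    have hq0 : 0 ≤ ∑ y', p y' * W y' u := sum_nonneg fun i _ => mul_nonneg (hp _) (hW0 _ _)
    rcases (hp y).eq_or_lt with h | h
    · simp [← h]
    rcases (hW0 y u).eq_or_lt with h' | h'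
    · rw [← h']
      simp only [mul_zero, zero_sub, zero_mul]
      exact div_nonpos_of_nonpos_of_nonneg (neg_nonpos.2 (mul_nonneg h.le hq0)) hl.le
    have hh := mul_pos h h'
    have h2 : 0 < ∑ y', p y' * W y' u := lt_of_lt_of_le hh
      (single_le_sum (f := fun y' => p y' * W y' u)
        (fun i _ => mul_nonneg (hp _) (hW0 _ _)) (mem_univ y))
    set q := ∑ y', p y' * W y' u
    have h3 := Real.one_sub_inv_le_log_of_pos (div_pos h' h2)
    unfold Real.logb
    rw [← mul_div_assoc]
    gcongr
    calc p y * W y u - p y * q = p y * W y u * (1 - (W y u / q)⁻¹) := by field_simp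
      _ ≤ _ := mul_le_mul_of_nonneg_left h3 hh.le
  refine le_trans (le_of_eq ?_) (sum_le_sum fun y _ => sum_le_sum fun u _ => key y u)
  have e : ∑ u, ∑ y', p y' * W y' u = 1 := by
    rw [sum_comm]; simp only [← mul_sum, hW1, mul_one, hp1]
  simp only [← sum_div, sum_sub_distrib, ← mul_sum, e, hW1, mul_one, sub_self, zero_div, sum_const_zero]

end WAK

namespace WAK

open Finset

lemma half_le_floor (x : ℝ) (hx : 1 ≤ x) : x / 2 ≤ (⌊x⌋₊ : ℝ) ∧ 0 < ⌊x⌋₊ := by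
  have h1 : 0 < ⌊x⌋₊ := Nat.floor_pos.2 hx
  have h2 := Nat.lt_floor_add_one x
  have h3 : (1 : ℝ) ≤ (⌊x⌋₊ : ℝ) := by exact_mod_cast h1
  exact ⟨by linarith, h1⟩

lemma prod_sum_eq {V : Type} [Fintype V] (n : ℕ) (F : Fin n → V → ℝ) :
    ∑ c : Fin n → V, ∏ t, F t (c t) = ∏ t, ∑ v, F t v := by
  have e := Finset.prod_univ_sum (fun _ : Fin n => (univ : Finset V)) F
  simp only [Fintype.piFinset_univ] at e
  exact e.symm

end WAK

/-- Achievability (direct part) of the Wyner–Ahlswede–Körner theorem. -/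
theorem wak_direct
    {X Y U : Type} [Fintype X] [Fintype Y] [Fintype U] [DecidableEq X]
    (P : X × Y → ℝ) (hP0 : ∀ z, 0 ≤ P z) (hP1 : ∑ z, P z = 1)
    (W : Y → U → ℝ) (hW0 : ∀ y u, 0 ≤ W y u) (hW1 : ∀ y, ∑ u, W y u = 1)
    (δ ε : ℝ) (hδ : 0 < δ) (hε : 0 < ε) :
    ∃ N : ℕ, ∀ n, N ≤ n →
      ∃ (M L : Type) (_ : Fintype M) (_ : Fintype L)
        (f : (Fin n → X) → M) (g : (Fin n → Y) → L)
        (D : M × L → (Fin n → X)),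
        (Fintype.card M : ℝ) ≤
          2 ^ ((n : ℝ) * (condEnt (fun z : X × U => ∑ y, P (z.1, y) * W y z.2) + δ)) ∧
        (Fintype.card L : ℝ) ≤
          2 ^ ((n : ℝ) * (mutInfo (fun z : U × Y => (∑ x, P (x, z.2)) * W z.2 z.1) + δ)) ∧
        ∑ xs : Fin n → X, ∑ ys : Fin n → Y,
          (if D (f xs, g ys) ≠ xs then ∏ t, P (xs t, ys t) else 0) ≤ ε := by
  classical
  set J : X × U → ℝ := fun z : X × U => ∑ y, P (z.1, y) * W y z.2 with hJ
  set pY : Y → ℝ := fun y => ∑ x, P (x, y) with hpY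
  have hpY0 : ∀ y, 0 ≤ pY y := fun y => Finset.sum_nonneg fun x _ => hP0 _
  have hpY1 : ∑ y, pY y = 1 := by
    rw [← hP1, Fintype.sum_prod_type_right]
  set q : U → ℝ := fun u => ∑ y, pY y * W y u with hq
  have hJ0 : ∀ z, 0 ≤ J z := fun z => Finset.sum_nonneg fun y _ => mul_nonneg (hP0 _) (hW0 _ _)
  have hq0 : ∀ u, 0 ≤ q u := fun z => Finset.sum_nonneg fun y _ => mul_nonneg (hpY0 _) (hW0 _ _)
  have hq1 : ∑ u, q u = 1 := by
    rw [hq, Finset.sum_comm]; simp only [← Finset.mul_sum, hW1, mul_one, hpY1]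
  have hJq : ∀ u, ∑ x, J (x, u) = q u := by
    intro u
    simp only [hJ, hq, hpY]
    rw [Finset.sum_comm]
    exact Finset.sum_congr rfl fun y _ => by rw [Finset.sum_mul]
  have hJle : ∀ x u, J (x, u) ≤ q u := fun x u => by
    rw [← hJq u]
    exact Finset.single_le_sum (f := fun x => J (x, u)) (fun i _ => hJ0 _) (Finset.mem_univ x)
  have hJpos : ∀ x y u, 0 < P (x, y) → 0 < W y u → 0 < J (x, u) := fun x y u h1 h2 =>
    lt_of_lt_of_le (mul_pos h1 h2) (Finset.single_le_sum (f := fun y => P (x, y) * W y u)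
      (fun i _ => mul_nonneg (hP0 _) (hW0 _ _)) (Finset.mem_univ y))
  have hH0 : 0 ≤ condEnt J := WAK.condEnt_nonneg J hJ0
  have hI0 := WAK.mutInfo_nonneg pY hpY0 hpY1 W hW0 hW1
  have hHe := WAK.condEnt_eq J hJ0
  have hIe := WAK.mutInfo_eq pY hpY0 W hW0 hW1
  set H := condEnt J with hH
  change ∃ N : ℕ, ∀ n, N ≤ n →
      ∃ (M L : Type) (_ : Fintype M) (_ : Fintype L)
        (f : (Fin n → X) → M) (g : (Fin n → Y) → L)
        (D : M × L → (Fin n → X)),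
        (Fintype.card M : ℝ) ≤ 2 ^ ((n : ℝ) * (H + δ)) ∧
        (Fintype.card L : ℝ) ≤
          2 ^ ((n : ℝ) * (mutInfo (fun z : U × Y => pY z.2 * W z.2 z.1) + δ)) ∧
        ∑ xs : Fin n → X, ∑ ys : Fin n → Y,
          (if D (f xs, g ys) ≠ xs then ∏ t, P (xs t, ys t) else 0) ≤ ε
  set I := mutInfo (fun z : U × Y => pY z.2 * W z.2 z.1) with hI
  set θ : ℝ := min (ε / 6) 1 with hθ
  have hθ0 : 0 < θ := lt_min (by positivity) one_pos
  have hθ1 : θ ≤ 1 := min_le_right _ _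
  have hθε : θ ≤ ε / 6 := min_le_left _ _
  have hη0 : 0 < θ ^ 2 := by positivity
  have hμ1 : ∑ x, ∑ y, ∑ u, P (x, y) * W y u * -Real.logb 2 (J (x, u) / q u) = H := by
    rw [hHe]
    refine Finset.sum_congr rfl fun x _ => ?_
    rw [Finset.sum_comm]
    refine Finset.sum_congr rfl fun u _ => ?_
    rw [hJq, ← Finset.sum_mul]
  have hμ2 : ∑ x, ∑ y, ∑ u, P (x, y) * W y u * Real.logb 2 (W y u / q u) = I := by
    rw [hIe, Finset.sum_comm]
    refine Finset.sum_congr rfl fun y _ => ?_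
    rw [Finset.sum_comm]
    refine Finset.sum_congr rfl fun u _ => ?_
    rw [← Finset.sum_mul, ← Finset.sum_mul]
  obtain ⟨N1, hN1⟩ := WAK.chernoff3 P hP0 hP1 W hW0 hW1
    (fun x y u => -Real.logb 2 (J (x, u) / q u)) H hμ1 (δ / 2) (θ ^ 2) (by positivity) hη0
  obtain ⟨N2, hN2⟩ := WAK.chernoff3 P hP0 hP1 W hW0 hW1
    (fun x y u => Real.logb 2 (W y u / q u)) I hμ2 (δ / 2) (θ ^ 2) (by positivity) hη0
  obtain ⟨N3, hN3⟩ : ∃ N3 : ℕ, ∀ n, N3 ≤ n → 8 / ε ≤ (2 : ℝ) ^ ((n : ℝ) * (δ / 2)) := by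
    have hb : (1 : ℝ) < 2 ^ (δ / 2) := Real.one_lt_rpow (by norm_num) (by positivity)
    have ht := tendsto_pow_atTop_atTop_of_one_lt hb
    obtain ⟨N, hN⟩ := Filter.eventually_atTop.1 (ht.eventually_ge_atTop (8 / ε))
    refine ⟨N, fun n hn => (hN n hn).trans (le_of_eq ?_)⟩
    rw [mul_comm, Real.rpow_mul (by norm_num), Real.rpow_natCast]
  refine ⟨max N1 (max N2 N3), fun n hn => ?_⟩
  have hn1 : N1 ≤ n := (le_max_left _ _).trans hn
  have hn2 : N2 ≤ n := ((le_max_left _ _).trans (le_max_right _ _)).trans hn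
  have hn3 : N3 ≤ n := ((le_max_right _ _).trans (le_max_right _ _)).trans hn
  set b : ℝ := (2 : ℝ) ^ ((n : ℝ) * (δ / 2)) with hb
  have hb0 : 0 < b := by positivity
  have hbε : 8 / ε ≤ b := hN3 n hn3
  set R : ℝ := (2 : ℝ) ^ ((n : ℝ) * (H + δ / 2)) with hR
  set Γ : ℝ := (2 : ℝ) ^ ((n : ℝ) * (I + δ / 2)) with hΓ
  have hR0 : 0 < R := by positivity
  have hΓ0 : 0 < Γ := by positivity
  have hRb : (2 : ℝ) ^ ((n : ℝ) * (H + δ)) = R * b := by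
    rw [hR, hb, ← Real.rpow_add (by norm_num)]; congr 1; ring
  have hΓb : (2 : ℝ) ^ ((n : ℝ) * (I + δ)) = Γ * b := by
    rw [hΓ, hb, ← Real.rpow_add (by norm_num)]; congr 1; ring
  have hM1 : 1 ≤ (2 : ℝ) ^ ((n : ℝ) * (H + δ)) :=
    Real.one_le_rpow (by norm_num) (by positivity)
  have hK1 : 1 ≤ (2 : ℝ) ^ ((n : ℝ) * (I + δ)) :=
    Real.one_le_rpow (by norm_num) (by positivity)
  obtain ⟨hMh, hMp⟩ := WAK.half_le_floor _ hM1
  obtain ⟨hKh, hKp⟩ := WAK.half_le_floor _ hK1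
  have hMle := Nat.floor_le (zero_le_one.trans hM1)
  have hKle := Nat.floor_le (zero_le_one.trans hK1)
  set M := ⌊(2 : ℝ) ^ ((n : ℝ) * (H + δ))⌋₊ with hM
  set K := ⌊(2 : ℝ) ^ ((n : ℝ) * (I + δ))⌋₊ with hK
  -- the typical set
  let T : (Fin n → U) → (Fin n → X) → Prop := fun c a =>
    0 < ∏ t, J (a t, c t) ∧ ∏ t, q (c t) ≤ R * ∏ t, J (a t, c t)
  have hTcard : ∀ c, ((Finset.univ.filter (T c)).card : ℝ) ≤ R := by
    intro c
    by_cases hc : 0 < ∏ t, q (c t)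
    · have h1 : ((Finset.univ.filter (T c)).card : ℝ) * ∏ t, q (c t) ≤ R * ∏ t, q (c t) := by
        calc ((Finset.univ.filter (T c)).card : ℝ) * ∏ t, q (c t)
            = ∑ a ∈ Finset.univ.filter (T c), ∏ t, q (c t) := by
              rw [Finset.sum_const, nsmul_eq_mul]
          _ ≤ ∑ a ∈ Finset.univ.filter (T c), R * ∏ t, J (a t, c t) :=
              Finset.sum_le_sum fun a ha => (Finset.mem_filter.1 ha).2.2
          _ ≤ ∑ a : Fin n → X, R * ∏ t, J (a t, c t) :=
              Finset.sum_le_sum_of_subset_of_nonneg (Finset.filter_subset _ _)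
                fun a _ _ => mul_nonneg hR0.le (Finset.prod_nonneg fun t _ => hJ0 _)
          _ = R * ∏ t, q (c t) := by
              rw [← Finset.mul_sum, WAK.prod_sum_eq n (fun t x => J (x, c t))]
              simp only [hJq]
      exact le_of_mul_le_mul_right h1 hc
    · have : Finset.univ.filter (T c) = ∅ := by
        refine Finset.filter_eq_empty_iff.2 fun a _ ha => hc ?_
        exact lt_of_lt_of_le ha.1 (Finset.prod_le_prod (fun t _ => hJ0 _) fun t _ => hJle _ _)
      rw [this]; simpa using hR0.le
  have hB1 := hN1 n hn1 (fun a b c => ¬ T c a) (by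
    intro a b c h1 h2 hT
    by_contra hcon
    push Not at hcon
    apply hT
    have hJp : ∀ t, 0 < J (a t, c t) := fun t => hJpos _ _ _ (h1 t) (h2 t)
    have hqp : ∀ t, 0 < q (c t) := fun t => (hJp t).trans_le (hJle _ _)
    refine ⟨Finset.prod_pos fun t _ => hJp t, ?_⟩
    have e : ∏ t, q (c t) = (2 : ℝ) ^ (∑ t, -Real.logb 2 (J (a t, c t) / q (c t)))
        * ∏ t, J (a t, c t) := by
      rw [Real.rpow_sum_of_pos (by norm_num), ← Finset.prod_mul_distrib]
      refine Finset.prod_congr rfl fun t _ => ?_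
      rw [Real.rpow_neg (by norm_num), Real.rpow_logb (by norm_num) (by norm_num)
        (div_pos (hJp t) (hqp t))]
      have := (hJp t).ne'
      have := (hqp t).ne'
      field_simp
    rw [e]
    refine mul_le_mul_of_nonneg_right ?_ (Finset.prod_nonneg fun t _ => hJ0 _)
    exact Real.rpow_le_rpow_of_exponent_le (by norm_num) hcon)
  have hB2 := hN2 n hn2 (fun a b c => ¬ ∏ t, W (b t) (c t) ≤ Γ * ∏ t, q (c t)) (by
    intro a b c h1 h2 hT
    by_contra hcon
    push Not at hcon
    apply hT
    have hJp : ∀ t, 0 < J (a t, c t) := fun t => hJpos _ _ _ (h1 t) (h2 t)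
    have hqp : ∀ t, 0 < q (c t) := fun t => (hJp t).trans_le (hJle _ _)
    have e : ∏ t, W (b t) (c t) = (2 : ℝ) ^ (∑ t, Real.logb 2 (W (b t) (c t) / q (c t)))
        * ∏ t, q (c t) := by
      rw [Real.rpow_sum_of_pos (by norm_num), ← Finset.prod_mul_distrib]
      refine Finset.prod_congr rfl fun t _ => ?_
      rw [Real.rpow_logb (by norm_num) (by norm_num) (div_pos (h2 t) (hqp t))]
      have := (hqp t).ne'
      field_simp
    rw [e]
    refine mul_le_mul_of_nonneg_right ?_ (Finset.prod_nonneg fun t _ => hq0 _)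
    exact Real.rpow_le_rpow_of_exponent_le (by norm_num) hcon)
  obtain ⟨f, g, D, hD⟩ := WAK.oneshot
    (fun (a : Fin n → X) (b : Fin n → Y) => ∏ t, P (a t, b t))
    (fun a b => Finset.prod_nonneg fun t _ => hP0 _)
    (by
      have e1 : ∀ a : Fin n → X, ∑ b : Fin n → Y, ∏ t, P (a t, b t) = ∏ t, ∑ y, P (a t, y) :=
        fun a => WAK.prod_sum_eq n (fun t y => P (a t, y))
      simp only [e1]
      rw [WAK.prod_sum_eq n (fun t x => ∑ y, P (x, y)), ← Fintype.sum_prod_type, hP1]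
      simp)
    (fun b c => ∏ t, W (b t) (c t)) (fun b c => Finset.prod_nonneg fun t _ => hW0 _ _)
    (by
      intro b
      rw [WAK.prod_sum_eq n (fun t u => W (b t) u)]
      simp [hW1])
    (fun c => ∏ t, q (c t)) (fun c => Finset.prod_nonneg fun t _ => hq0 _)
    (by rw [WAK.prod_sum_eq n (fun t u => q u)]; simp [hq1])
    T K hKp M hMp Γ hΓ0 (θ ^ 2) θ hθ0 R (by intro c; convert hTcard c)
    (by convert hB1) (by convert hB2)
  refine ⟨Fin M, Fin K, inferInstance, inferInstance, f, g, D, ?_, ?_, ?_⟩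
  · rw [Fintype.card_fin]; exact hMle
  · rw [Fintype.card_fin]; exact hKle
  · refine hD.trans ?_
    have hMp' : (0 : ℝ) < M := by exact_mod_cast hMp
    have r1 : R / M ≤ 2 / b := by
      rw [div_le_div_iff₀ hMp' hb0]
      rw [hRb] at hMh
      linarith
    have r2 : Real.exp (-(K / Γ)) ≤ 2 / b := by
      have k1 : b / 2 ≤ K / Γ := by
        rw [le_div_iff₀ hΓ0]
        rw [hΓb] at hKh
        linarith
      have k2 : b / 2 ≤ Real.exp (K / Γ) :=
        k1.trans ((by linarith [Real.add_one_le_exp ((K : ℝ) / Γ)]))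
      rw [Real.exp_neg, show 2 / b = (b / 2)⁻¹ by rw [inv_div]]
      exact inv_anti₀ (by positivity) k2
    have r3 : 2 / b ≤ ε / 4 := by
      rw [div_le_iff₀ hε] at hbε
      rw [div_le_div_iff₀ hb0 (by norm_num)]
      linarith
    have r4 : θ ^ 2 / θ = θ := by field_simp
    have r5 : θ ^ 2 ≤ θ := by nlinarith
    rw [r4]
    linarith
end

section
/- Converse part of the Wyner–Ahlswede–Körner theorem: Let X, Y be finite alphabets and P_XY a joint pmf on X × Y. Suppose the rate pair (R1, R2) is achievable, i.e., for every ε > 0 and δ > 0 and all sufficiently large n there exist finite sets M, L with |M| ≤ 2^{n(R1+δ)}, |L| ≤ 2^{n(R2+δ)}, an encoder f : X^n → M, a helper map g : Y^n → L, and a decoder D : M × L → X^n whose error probability P_XY^{⊗n}{(x^n,y^n) : D(f(x^n), g(y^n)) ≠ x^n} is at most ε. Then there exist a finite set U and a conditional pmf W(u|y) from Y to U such that, under the joint pmf P(x,y)·W(u|y), R1 ≥ H(X|U) and R2 ≥ I(U;Y). -/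
open scoped BigOperators

noncomputable def wG {X : Type*} [Fintype X] (v : X → ℝ) : ℝ :=
  ∑ x, Real.negMulLog (v x) - Real.negMulLog (∑ x, v x)

noncomputable def wPY {X Y : Type*} [Fintype X] (P : X × Y → ℝ) (y : Y) : ℝ := ∑ x, P (x, y)

noncomputable def wF1 {X Y : Type*} [Fintype X] [Fintype Y] (P : X × Y → ℝ) (w : Y → ℝ) : ℝ :=
  wG (fun x => ∑ y, P (x, y) * w y)

noncomputable def wF2 {X Y : Type*} [Fintype X] [Fintype Y] (P : X × Y → ℝ) (w : Y → ℝ) : ℝ :=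
  Real.negMulLog (∑ y, wPY P y * w y) - ∑ y, wPY P y * Real.negMulLog (w y)

lemma wG_smul {X : Type*} [Fintype X] (c : ℝ) (v : X → ℝ) :
    wG (fun x => c * v x) = c * wG v := by
  unfold wG
  simp only [← Finset.mul_sum, Real.negMulLog_mul, Finset.sum_add_distrib, ← Finset.sum_mul]
  ring

/-- Gibbs inequality -/
lemma wG_gibbs {X : Type*} [Fintype X] (v q : X → ℝ) (hv : ∀ x, 0 ≤ v x) (hq : ∀ x, 0 < q x)
    (hq1 : ∑ x, q x ≤ 1) : wG v ≤ ∑ x, v x * (-Real.log (q x)) := by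
  unfold wG
  set V := ∑ x, v x with hV
  have hV0 : 0 ≤ V := Finset.sum_nonneg fun x _ => hv x
  have key : ∀ x, Real.negMulLog (v x) + v x * Real.log V
      ≤ v x * (-Real.log (q x)) + (V * q x - v x) := by
    intro x
    rcases (hv x).eq_or_lt with h | h
    · rw [← h]; simp; exact mul_nonneg hV0 (hq x).le
    · have hVp : 0 < V := lt_of_lt_of_le h
        (Finset.single_le_sum (f := v) (fun x _ => hv x) (Finset.mem_univ x))
      have h1 := Real.log_le_sub_one_of_pos (show 0 < V * q x / v x from div_pos (mul_pos hVp (hq x)) h)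
      rw [Real.log_div (mul_pos hVp (hq x)).ne' h.ne', Real.log_mul hVp.ne' (hq x).ne'] at h1
      have h2 := mul_le_mul_of_nonneg_left h1 h.le
      have h3 : v x * (V * q x / v x - 1) = V * q x - v x := by field_simp
      rw [h3] at h2
      unfold Real.negMulLog
      linarith
  have := Finset.sum_le_sum fun x (_ : x ∈ Finset.univ) => key x
  simp only [Finset.sum_add_distrib, Finset.sum_sub_distrib, ← Finset.mul_sum, ← Finset.sum_mul,
    ← hV] at this
  have h4 : V * ∑ x, q x ≤ V * 1 := mul_le_mul_of_nonneg_left hq1 hV0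
  have h5 : Real.negMulLog V = - (V * Real.log V) := by unfold Real.negMulLog; ring
  rw [h5]
  linarith

lemma wG_add {X : Type*} [Fintype X] (v w : X → ℝ) (hv : ∀ x, 0 ≤ v x) (hw : ∀ x, 0 ≤ w x) :
    wG v + wG w ≤ wG (fun x => v x + w x) := by
  have log_sum : ∀ a b A B : ℝ, 0 ≤ a → 0 ≤ b → a ≤ A → b ≤ B →
      a * (Real.log (a + b) - Real.log (A + B)) ≤ a * (Real.log a - Real.log A)
        + ((a + b) * (A / (A + B)) - a) := by
    intro a b A B ha hb hA hB
    rcases ha.eq_or_lt with h | h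
    · rw [← h]; simp
      exact mul_nonneg hb (div_nonneg (ha.trans hA) (add_nonneg (ha.trans hA) (hb.trans hB)))
    · have hAp : 0 < A := by linarith
      have hABp : 0 < A + B := by linarith
      have habp : 0 < a + b := by linarith
      have h1 := Real.log_le_sub_one_of_pos
        (show 0 < ((a + b) * A) / ((A + B) * a) by positivity)
      rw [Real.log_div (by positivity) (by positivity), Real.log_mul habp.ne' hAp.ne',
        Real.log_mul hABp.ne' h.ne'] at h1
      have h2 := mul_le_mul_of_nonneg_left h1 h.le
      have h3 : a * (((a + b) * A) / ((A + B) * a) - 1) = (a + b) * (A / (A + B)) - a := by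
        field_simp
      rw [h3] at h2
      linarith
  set V := ∑ x, v x with hV
  set W := ∑ x, w x with hW
  have rep : ∀ u : X → ℝ, wG u = ∑ x, - (u x * (Real.log (u x) - Real.log (∑ x, u x))) := by
    intro u
    unfold wG Real.negMulLog
    simp only [Finset.sum_neg_distrib, mul_sub, Finset.sum_sub_distrib, neg_mul, ← Finset.sum_mul]
    ring
  have hVW : ∑ x, (v x + w x) = V + W := Finset.sum_add_distrib
  rw [rep v, rep w, rep (fun x => v x + w x), ← Finset.sum_add_distrib, hVW, ← hV, ← hW]
  refine Finset.sum_le_sum fun x _ => ?_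
  have hvV : v x ≤ V := Finset.single_le_sum (f := v) (fun x _ => hv x) (Finset.mem_univ x)
  have hwW : w x ≤ W := Finset.single_le_sum (f := w) (fun x _ => hw x) (Finset.mem_univ x)
  have h1 := log_sum _ _ _ _ (hv x) (hw x) hvV hwW
  have h2 := log_sum _ _ _ _ (hw x) (hv x) hwW hvV
  rw [add_comm (w x), add_comm W] at h2
  have h3 : (v x + w x) * (V / (V + W)) + (v x + w x) * (W / (V + W)) ≤ v x + w x := by
    rw [← mul_add, ← add_div]
    exact mul_le_of_le_one_right (add_nonneg (hv x) (hw x)) (div_self_le_one _)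
  linarith

lemma wG_zero {X : Type*} [Fintype X] : wG (fun _ : X => (0:ℝ)) = 0 := by simp [wG]

lemma wG_sum {X B : Type*} [Fintype X] (s : Finset B) (v : B → X → ℝ) (hv : ∀ b x, 0 ≤ v b x) :
    ∑ b ∈ s, wG (v b) ≤ wG (fun x => ∑ b ∈ s, v b x) := by
  classical
  induction s using Finset.induction_on with
  | empty => simp [wG_zero]
  | insert b s hb ih =>
    rw [Finset.sum_insert hb]
    simp only [Finset.sum_insert hb]
    exact (add_le_add le_rfl ih).trans (wG_add _ _ (hv b) fun x => Finset.sum_nonneg fun b _ => hv b x)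

lemma wF1_smul {X Y : Type*} [Fintype X] [Fintype Y] (P : X × Y → ℝ) (c : ℝ) (w : Y → ℝ) :
    wF1 P (fun y => c * w y) = c * wF1 P w := by
  unfold wF1
  rw [← wG_smul]
  congr 1; ext x; rw [Finset.mul_sum]; exact Finset.sum_congr rfl fun y _ => by ring

lemma wF2_smul {X Y : Type*} [Fintype X] [Fintype Y] (P : X × Y → ℝ) (c : ℝ) (w : Y → ℝ) :
    wF2 P (fun y => c * w y) = c * wF2 P w := by
  unfold wF2
  have : ∑ y, wPY P y * (c * w y) = c * ∑ y, wPY P y * w y := by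
    rw [Finset.mul_sum]; exact Finset.sum_congr rfl fun y _ => by ring
  rw [this]
  have h2 : ∑ y, wPY P y * Real.negMulLog (c * w y) = Real.negMulLog c * ∑ y, wPY P y * w y
      + c * ∑ y, wPY P y * Real.negMulLog (w y) := by
    rw [Finset.mul_sum, Finset.mul_sum, ← Finset.sum_add_distrib]
    exact Finset.sum_congr rfl fun y _ => by rw [Real.negMulLog_mul]; ring
  rw [h2, Real.negMulLog_mul]
  ring

noncomputable def wPn {X Y : Type*} (P : X × Y → ℝ) (n : ℕ) :
    (Fin n → X) × (Fin n → Y) → ℝ := fun z => ∏ t, P (z.1 t, z.2 t)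

lemma sum_cons {Y : Type*} [Fintype Y] (n : ℕ) (h : (Fin (n+1) → Y) → ℝ) :
    ∑ ys, h ys = ∑ y, ∑ b : Fin n → Y, h (Fin.cons y b) := by
  rw [← (Fin.consEquiv (fun _ : Fin (n+1) => Y)).sum_comp, Fintype.sum_prod_type]
  rfl

lemma wPn_cons {X Y : Type*} (P : X × Y → ℝ) (n : ℕ) (x : X) (a : Fin n → X) (y : Y)
    (b : Fin n → Y) : wPn P (n+1) (Fin.cons x a, Fin.cons y b) = P (x, y) * wPn P n (a, b) := by
  simp [wPn, Fin.prod_univ_succ]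

lemma wPY_cons {X Y : Type*} [Fintype X] (P : X × Y → ℝ) (n : ℕ) (y : Y)
    (b : Fin n → Y) : wPY (wPn P (n+1)) (Fin.cons y b) = wPY P y * wPY (wPn P n) b := by
  unfold wPY
  rw [sum_cons, Finset.sum_mul_sum]
  simp only [wPn_cons]

lemma wPn_nonneg {X Y : Type*} (P : X × Y → ℝ) (hP : ∀ z, 0 ≤ P z) (n : ℕ) (z) :
    0 ≤ wPn P n z := Finset.prod_nonneg fun _ _ => hP _

lemma wPY_nonneg {X Y : Type*} [Fintype X] (P : X × Y → ℝ) (hP : ∀ z, 0 ≤ P z) (y) :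
    0 ≤ wPY P y := Finset.sum_nonneg fun _ _ => hP _

lemma wPY_sum {X Y : Type*} [Fintype X] [Fintype Y] (P : X × Y → ℝ) (hP1 : ∑ z, P z = 1) :
    ∑ y, wPY P y = 1 := by
  unfold wPY; rw [← hP1, Fintype.sum_prod_type, Finset.sum_comm]

lemma wPYn_sum {X Y : Type*} [Fintype X] [Fintype Y] (P : X × Y → ℝ) (hP1 : ∑ z, P z = 1) (n : ℕ) :
    ∑ y, wPY (wPn P n) y = 1 := by
  induction n with
  | zero => simp [wPY, wPn]
  | succ n ih =>
    rw [sum_cons]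
    simp only [wPY_cons]
    rw [← Finset.sum_mul_sum, ih, wPY_sum P hP1, one_mul]

lemma step1 {X Y : Type*} [Fintype X] [Fintype Y] (P : X × Y → ℝ) (hP : ∀ z, 0 ≤ P z) (n : ℕ)
    (w : (Fin (n+1) → Y) → ℝ) (hw : ∀ y, 0 ≤ w y) :
    wF1 (wPn P n) (fun b => ∑ y, wPY P y * w (Fin.cons y b)) +
      ∑ b, wF1 P (fun y => wPY (wPn P n) b * w (Fin.cons y b)) ≤ wF1 (wPn P (n+1)) w := by
  set s : (Fin n → Y) → X → ℝ := fun b x => ∑ y, P (x, y) * w (Fin.cons y b) with hs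
  have hs0 : ∀ b x, 0 ≤ s b x := fun b x => Finset.sum_nonneg fun y _ => mul_nonneg (hP _) (hw _)
  set r : (Fin n → X) → X → ℝ := fun a x => ∑ b, wPn P n (a, b) * s b x with hr
  have hL : ∀ x a, ∑ ys, wPn P (n+1) (Fin.cons x a, ys) * w ys = r a x := by
    intro x a
    rw [sum_cons, Finset.sum_comm]
    simp only [hr, hs, wPn_cons, Finset.mul_sum]
    exact Finset.sum_congr rfl fun b _ => Finset.sum_congr rfl fun y _ => by ring
  have hA : ∀ a, ∑ b, wPn P n (a, b) * ∑ y, wPY P y * w (Fin.cons y b) = ∑ x, r a x := by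
    intro a
    simp only [hr, hs]
    rw [Finset.sum_comm]
    refine Finset.sum_congr rfl fun b _ => ?_
    rw [← Finset.mul_sum, Finset.sum_comm]
    simp only [wPY, Finset.sum_mul]
  have key : ∑ b, wPY (wPn P n) b * wG (s b) ≤ ∑ a, wG (r a) := by
    have : ∀ a, ∑ b, wPn P n (a, b) * wG (s b) ≤ wG (r a) := by
      intro a
      simp only [← wG_smul]
      exact wG_sum _ _ fun b x => mul_nonneg (wPn_nonneg P hP n _) (hs0 b x)
    refine le_trans (le_of_eq ?_) (Finset.sum_le_sum fun a _ => this a)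
    rw [Finset.sum_comm]
    exact Finset.sum_congr rfl fun b _ => by rw [wPY, Finset.sum_mul]
  simp only [wF1_smul]
  change _ + ∑ b, wPY (wPn P n) b * wG (s b) ≤ _
  unfold wF1
  simp only [hA]
  have h1 : wG (fun x => ∑ y, wPn P (n+1) (x, y) * w y)
      = ∑ a, ∑ x, Real.negMulLog (r a x) - Real.negMulLog (∑ a, ∑ x, r a x) := by
    unfold wG
    rw [sum_cons, sum_cons]
    simp only [hL]
    rw [Finset.sum_comm, Finset.sum_comm (f := fun x a => r a x)]
  rw [h1]
  have h2 : ∑ a, wG (r a) = ∑ a, ∑ x, Real.negMulLog (r a x) - ∑ a, Real.negMulLog (∑ x, r a x) := by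
    unfold wG; rw [Finset.sum_sub_distrib]
  rw [h2] at key
  rw [wG]
  linarith

lemma step2 {X Y : Type*} [Fintype X] [Fintype Y] (P : X × Y → ℝ) (n : ℕ)
    (w : (Fin (n+1) → Y) → ℝ) :
    wF2 (wPn P n) (fun b => ∑ y, wPY P y * w (Fin.cons y b)) +
      ∑ b, wF2 P (fun y => wPY (wPn P n) b * w (Fin.cons y b)) = wF2 (wPn P (n+1)) w := by
  simp only [wF2_smul]
  unfold wF2
  rw [sum_cons, sum_cons]
  simp only [wPY_cons, mul_sub, Finset.sum_sub_distrib]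
  have h1 : ∑ b, wPY (wPn P n) b * ∑ y, wPY P y * w (Fin.cons y b) =
    ∑ y, ∑ b, wPY P y * wPY (wPn P n) b * w (Fin.cons y b) := by
    rw [Finset.sum_comm]
    simp only [Finset.mul_sum]
    exact Finset.sum_congr rfl fun b _ => Finset.sum_congr rfl fun y _ => by ring
  have h2 : ∑ b, wPY (wPn P n) b * ∑ y, wPY P y * Real.negMulLog (w (Fin.cons y b)) =
    ∑ y, ∑ b, wPY P y * wPY (wPn P n) b * Real.negMulLog (w (Fin.cons y b)) := by
    rw [Finset.sum_comm]
    simp only [Finset.mul_sum]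
    exact Finset.sum_congr rfl fun b _ => Finset.sum_congr rfl fun y _ => by ring
  rw [h1, h2]
  ring

lemma single_letter {X Y : Type} [Fintype X] [Fintype Y] (P : X × Y → ℝ) (hP : ∀ z, 0 ≤ P z)
    (hP1 : ∑ z, P z = 1) (n : ℕ) (L : Type) [Fintype L] :
    ∀ (W : (Fin n → Y) → L → ℝ) (_ : ∀ y l, 0 ≤ W y l) (_ : ∀ y, ∑ l, W y l = 1),
    ∃ (U : Type) (_ : Fintype U) (V : Y → U → ℝ), (∀ y u, 0 ≤ V y u) ∧ (∀ y, ∑ u, V y u = n) ∧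
      ∑ u, wF1 P (fun y => V y u) ≤ ∑ l, wF1 (wPn P n) (fun y => W y l) ∧
      ∑ u, wF2 P (fun y => V y u) ≤ ∑ l, wF2 (wPn P n) (fun y => W y l) := by
  induction n with
  | zero =>
    intro W hW hW1
    refine ⟨Empty, inferInstance, fun _ u => u.elim, fun _ u => u.elim, by simp, ?_, ?_⟩
    · simp [wF1, wG]
    · simp [wF2, wPY, wPn]
  | succ n ih =>
    intro W hW hW1
    obtain ⟨U, _, V, hV, hV1, h1, h2⟩ := ih (fun b l => ∑ y, wPY P y * W (Fin.cons y b) l)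
      (fun b l => Finset.sum_nonneg fun y _ => mul_nonneg (wPY_nonneg P hP y) (hW _ _))
      (fun b => by
        rw [Finset.sum_comm]
        simp only [← Finset.mul_sum, hW1, mul_one]
        exact wPY_sum P hP1)
    refine ⟨U ⊕ (L × (Fin n → Y)), inferInstance,
      fun y => Sum.elim (V y) (fun p => wPY (wPn P n) p.2 * W (Fin.cons y p.2) p.1), ?_, ?_, ?_, ?_⟩
    · rintro y (u | p)
      · exact hV y u
      · exact mul_nonneg (wPY_nonneg _ (wPn_nonneg P hP n) _) (hW _ _)
    · intro y
      rw [Fintype.sum_sum_type]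
      simp only [Sum.elim_inl, Sum.elim_inr, hV1]
      rw [Fintype.sum_prod_type, Finset.sum_comm]
      simp only [← Finset.mul_sum, hW1, mul_one, wPYn_sum P hP1]
      push_cast; rfl
    · rw [Fintype.sum_sum_type]
      simp only [Sum.elim_inl, Sum.elim_inr]
      rw [Fintype.sum_prod_type]
      refine (add_le_add h1 le_rfl).trans ?_
      rw [← Finset.sum_add_distrib]
      exact Finset.sum_le_sum fun l _ => step1 P hP n (fun y => W y l) (fun y => hW y l)
    · rw [Fintype.sum_sum_type]
      simp only [Sum.elim_inl, Sum.elim_inr]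
      rw [Fintype.sum_prod_type]
      refine (add_le_add h2 le_rfl).trans ?_
      rw [← Finset.sum_add_distrib]
      exact Finset.sum_le_sum fun l _ => (step2 P n (fun y => W y l)).le

lemma isCompact_convexHull_fd {E : Type} [NormedAddCommGroup E] [NormedSpace ℝ E]
    [FiniteDimensional ℝ E] (S : Set E) (hS : IsCompact S) : IsCompact (convexHull ℝ S) := by
  classical
  rcases S.eq_empty_or_nonempty with rfl | ⟨s0, hs0⟩
  · simp
  set d := Module.finrank ℝ E + 1 with hd
  have hK : IsCompact ((stdSimplex ℝ (Fin d)) ×ˢ (Set.univ.pi (fun _ : Fin d => S))) :=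
    (isCompact_stdSimplex ℝ (Fin d)).prod (isCompact_univ_pi fun _ => hS)
  have hc : Continuous (fun p : (Fin d → ℝ) × (Fin d → E) => ∑ i, p.1 i • p.2 i) := by fun_prop
  have := hK.image hc
  convert this using 1
  ext x
  constructor
  · intro hx
    obtain ⟨ι, _, z, w, hz, hai, hw, hw1, hx⟩ := eq_pos_convex_span_of_mem_convexHull hx
    have hcard : Fintype.card ι ≤ Fintype.card (Fin d) := by
      rw [Fintype.card_fin]
      exact hai.card_le_finrank_succ.trans
        (Nat.succ_le_succ (Submodule.finrank_le _))
    obtain ⟨e⟩ := Function.Embedding.nonempty_of_card_le hcard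
    have hsum : ∀ {A : Type} [AddCommMonoid A] (h : Fin d → A), (∀ j, j ∉ Set.range e → h j = 0) →
        ∑ j, h j = ∑ i, h (e i) := by
      intro A _ h hh
      rw [← Finset.sum_map Finset.univ e h]
      symm
      apply Finset.sum_subset (Finset.subset_univ _)
      intro j _ hj
      apply hh
      simpa using hj
    have hE : ∀ j, j ∉ Set.range e → Function.extend e w 0 j = 0 := fun j hj => by
      rw [Function.extend_apply' _ _ _ (by simpa using hj)]; rfl
    refine ⟨(Function.extend e w 0, Function.extend e z fun _ => s0), ⟨⟨?_, ?_⟩, ?_⟩, ?_⟩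
    · intro j
      by_cases hj : j ∈ Set.range e
      · obtain ⟨i, rfl⟩ := hj
        simp only [e.injective.extend_apply]; exact (hw i).le
      · exact (hE j hj).ge
    · simp only
      rw [hsum _ hE]
      simp only [e.injective.extend_apply]; exact hw1
    · intro j _
      by_cases hj : j ∈ Set.range e
      · obtain ⟨i, rfl⟩ := hj
        simp only [e.injective.extend_apply]; exact hz ⟨i, rfl⟩
      · simp only
        rw [Function.extend_apply' _ _ _ (by simpa using hj)]; exact hs0
    · simp only
      rw [hsum _ (fun j hj => by rw [hE j hj, zero_smul])]
      simp only [e.injective.extend_apply]; exact hx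
  · rintro ⟨⟨w, z⟩, ⟨⟨hw, hw1⟩, hz⟩, rfl⟩
    exact mem_convexHull_of_exists_fintype w z hw hw1 (fun i => hz i (Set.mem_univ i)) rfl

lemma wF1_cont {X Y : Type*} [Fintype X] [Fintype Y] (P : X × Y → ℝ) : Continuous (wF1 P) := by
  unfold wF1 wG; fun_prop

lemma wF2_cont {X Y : Type*} [Fintype X] [Fintype Y] (P : X × Y → ℝ) : Continuous (wF2 P) := by
  unfold wF2; fun_prop

lemma compact_region {Y : Type} [Fintype Y] [Nonempty Y] (F1 F2 : (Y → ℝ) → ℝ)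
    (c1 : Continuous F1) (c2 : Continuous F2)
    (s1 : ∀ (c : ℝ) w, F1 (fun y => c * w y) = c * F1 w)
    (s2 : ∀ (c : ℝ) w, F2 (fun y => c * w y) = c * F2 w) (A B : ℝ)
    (h : ∀ η > (0:ℝ), ∃ (U : Type) (_ : Fintype U) (W : Y → U → ℝ), (∀ y u, 0 ≤ W y u) ∧
      (∀ y, ∑ u, W y u = 1) ∧ ∑ u, F1 (fun y => W y u) ≤ A + η ∧
      ∑ u, F2 (fun y => W y u) ≤ B + η) :
    ∃ (U : Type) (_ : Fintype U) (W : Y → U → ℝ), (∀ y u, 0 ≤ W y u) ∧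
      (∀ y, ∑ u, W y u = 1) ∧ ∑ u, F1 (fun y => W y u) ≤ A ∧
      ∑ u, F2 (fun y => W y u) ≤ B := by
  classical
  set k : ℝ := (Fintype.card Y : ℝ) with hk
  have hk0 : 0 < k := by rw [hk]; exact_mod_cast Fintype.card_pos
  set Φ : (Y → ℝ) → (Y → ℝ) × ℝ × ℝ := fun w => (w, F1 w, F2 w) with hΦ
  have hΦc : Continuous Φ := by fun_prop
  have hS := isCompact_convexHull_fd _ ((isCompact_stdSimplex ℝ Y).image hΦc)
  set K := convexHull ℝ (Φ '' stdSimplex ℝ Y) ∩ {p | p.1 = fun _ => k⁻¹} with hKdef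
  have hK : IsCompact K := hS.inter_right (isClosed_eq continuous_fst continuous_const)
  set φ : (Y → ℝ) × ℝ × ℝ → ℝ := fun p => max (p.2.1 - k⁻¹ * A) (p.2.2 - k⁻¹ * B) with hφ
  have hφc : Continuous φ := by fun_prop
  have hpt : ∀ η > (0:ℝ), ∃ p ∈ K, φ p ≤ k⁻¹ * η := by
    intro η hη
    obtain ⟨U, _, W, hW, hW1, h1, h2⟩ := h η hη
    set σ : U → ℝ := fun u => ∑ y, W y u with hσ
    have hσ0 : ∀ u, 0 ≤ σ u := fun u => Finset.sum_nonneg fun y _ => hW y u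
    set w : U → Y → ℝ := fun u y => if σ u = 0 then k⁻¹ else W y u / σ u with hw
    have hsw : ∀ u, (fun y => W y u) = fun y => σ u * w u y := by
      intro u; ext y
      by_cases h0 : σ u = 0
      · have := (Finset.sum_eq_zero_iff_of_nonneg (fun y _ => hW y u)).1 h0 y (Finset.mem_univ y)
        rw [h0, this, zero_mul]
      · simp only [hw, h0, if_false]; field_simp
    refine ⟨(fun _ => k⁻¹, k⁻¹ * ∑ u, F1 (fun y => W y u), k⁻¹ * ∑ u, F2 (fun y => W y u)),
      ⟨?_, rfl⟩, ?_⟩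
    · refine mem_convexHull_of_exists_fintype (fun u => k⁻¹ * σ u) (fun u => Φ (w u)) ?_ ?_ ?_ ?_
      · intro u; exact mul_nonneg (inv_nonneg.2 hk0.le) (hσ0 u)
      · rw [← Finset.mul_sum, Finset.sum_comm]
        simp only [hW1, Finset.sum_const, Finset.card_univ, nsmul_eq_mul, mul_one, ← hk]
        exact inv_mul_cancel₀ hk0.ne'
      · intro u
        refine ⟨_, ⟨?_, ?_⟩, rfl⟩
        · intro y
          by_cases h0 : σ u = 0
          · simp only [hw, h0, if_true]; positivity
          · simp only [hw, h0, if_false]; exact div_nonneg (hW y u) (hσ0 u)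
        · by_cases h0 : σ u = 0
          · simp only [hw, h0, if_true, Finset.sum_const, Finset.card_univ, nsmul_eq_mul, ← hk]
            exact mul_inv_cancel₀ hk0.ne'
          · simp only [hw, h0, if_false]
            rw [← Finset.sum_div]
            exact div_self h0
      · have e1 : ∀ u, F1 (fun y => W y u) = σ u * F1 (w u) := fun u => by rw [hsw, s1]
        have e2 : ∀ u, F2 (fun y => W y u) = σ u * F2 (w u) := fun u => by rw [hsw, s2]
        ext y
        · simp only [hΦ, Prod.fst_sum, Finset.sum_apply, Prod.smul_fst, Pi.smul_apply, smul_eq_mul]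
          have : ∀ u, k⁻¹ * σ u * w u y = k⁻¹ * W y u := fun u => by
            rw [mul_assoc, ← congrFun (hsw u) y]
          simp only [this, ← Finset.mul_sum, hW1, mul_one]
        · simp only [hΦ, Prod.fst_sum, Prod.snd_sum, Prod.smul_fst, Prod.smul_snd, smul_eq_mul, e1,
            Finset.mul_sum, mul_assoc]
        · simp only [hΦ, Prod.snd_sum, Prod.smul_snd, smul_eq_mul, e2,
            Finset.mul_sum, mul_assoc]
    · simp only [hφ, ← mul_sub]
      apply max_le <;> apply mul_le_mul_of_nonneg_left _ (inv_nonneg.2 hk0.le) <;> linarith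
  obtain ⟨p0, hp0, -⟩ := hpt 1 one_pos
  obtain ⟨p, hpK, hpmin⟩ := hK.exists_isMinOn ⟨p0, hp0⟩ hφc.continuousOn
  have hp : φ p ≤ 0 := by
    by_contra hcon
    push Not at hcon
    obtain ⟨q, hq, hq2⟩ := hpt (k * (φ p / 2)) (by positivity)
    have := isMinOn_iff.1 hpmin q hq
    rw [inv_mul_cancel_left₀ hk0.ne'] at hq2
    linarith
  obtain ⟨hpc, hp1⟩ := hpK
  obtain ⟨ι, _, μ, z, hμ, hμ1, hz, hzp⟩ := mem_convexHull_iff_exists_fintype.1 hpc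
  choose w hws hwz using hz
  have hp2 := max_le_iff.1 hp
  have q0 : ∀ y, ∑ i, μ i * w i y = k⁻¹ := by
    intro y
    have := congrFun hp1 y
    rw [← hzp] at this
    simpa [← hwz, hΦ, Prod.fst_sum] using this
  have q1 : ∑ i, μ i * F1 (w i) ≤ k⁻¹ * A := by
    have : p.2.1 = ∑ i, μ i * F1 (w i) := by
      rw [← hzp]; simp [← hwz, hΦ, Prod.fst_sum, Prod.snd_sum]
    linarith [hp2.1]
  have q2 : ∑ i, μ i * F2 (w i) ≤ k⁻¹ * B := by
    have : p.2.2 = ∑ i, μ i * F2 (w i) := by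
      rw [← hzp]; simp [← hwz, hΦ, Prod.snd_sum]
    linarith [hp2.2]
  refine ⟨ι, inferInstance, fun y i => (k * μ i) * w i y, ?_, ?_, ?_, ?_⟩
  · intro y i; exact mul_nonneg (mul_nonneg hk0.le (hμ i)) ((hws i).1 y)
  · intro y
    simp only [mul_assoc, ← Finset.mul_sum, q0]
    exact mul_inv_cancel₀ hk0.ne'
  · simp only [s1, mul_assoc, ← Finset.mul_sum]
    rwa [← div_eq_inv_mul, le_div_iff₀' hk0] at q1
  · simp only [s2, mul_assoc, ← Finset.mul_sum]
    rwa [← div_eq_inv_mul, le_div_iff₀' hk0] at q2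

lemma fano {A B M L : Type} [Fintype A] [Fintype B] [Fintype M] [Fintype L] [DecidableEq A]
    [DecidableEq L] [Nonempty A] (Q : A × B → ℝ) (hQ : ∀ z, 0 ≤ Q z) (hQ1 : ∑ y, wPY Q y = 1)
    (f : A → M) (g : B → L) (D : M × L → A) (ε : ℝ)
    (herr : ∑ a, ∑ b, (if D (f a, g b) ≠ a then Q (a, b) else 0) ≤ ε) :
    ∑ l, wF1 Q (fun b => if g b = l then 1 else 0)
      ≤ Real.log 2 + Real.log (Fintype.card M) + ε * Real.log (Fintype.card A) := by
  classical
  have : Nonempty M := ⟨f (Classical.arbitrary A)⟩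
  set m : ℝ := (Fintype.card M : ℝ) with hm
  set α : ℝ := (Fintype.card A : ℝ) with hα
  have hm1 : 1 ≤ m := by rw [hm]; exact_mod_cast Fintype.card_pos
  have hα1 : 1 ≤ α := by rw [hα]; exact_mod_cast Fintype.card_pos
  have hm0 : 0 < m := by linarith
  have hα0 : 0 < α := by linarith
  set q : L → A → ℝ := fun l a => (if a ∈ Finset.univ.image (fun i => D (i, l)) then (2 * m)⁻¹ else 0)
    + (2 * α)⁻¹ with hq
  have hq0 : ∀ l a, 0 < q l a := by
    intro l a
    simp only [hq]
    have : 0 < (2 * α)⁻¹ := by positivity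
    split_ifs <;> positivity
  have hq1 : ∀ l, ∑ a, q l a ≤ 1 := by
    intro l
    simp only [hq, Finset.sum_add_distrib]
    rw [Finset.sum_ite_mem, Finset.univ_inter]
    simp only [Finset.sum_const, nsmul_eq_mul, Finset.card_univ, ← hα]
    have h1 : ((Finset.univ.image (fun i => D (i, l))).card : ℝ) ≤ m := by
      rw [hm]; exact_mod_cast Finset.card_image_le
    have h2 : ((Finset.univ.image (fun i => D (i, l))).card : ℝ) * (2 * m)⁻¹ ≤ m * (2 * m)⁻¹ :=
      mul_le_mul_of_nonneg_right h1 (by positivity)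
    have h3 : m * (2 * m)⁻¹ = 1 / 2 := by field_simp
    have h4 : α * (2 * α)⁻¹ = 1 / 2 := by field_simp
    linarith
  have hc : ∀ a b, -Real.log (q (g b) a) ≤ Real.log 2 + Real.log m +
      (if D (f a, g b) ≠ a then 1 else 0) * Real.log α := by
    intro a b
    have hlm := Real.log_nonneg hm1
    by_cases h : D (f a, g b) = a
    · simp only [h, ne_eq, not_true_eq_false, if_false, zero_mul, add_zero]
      rw [← Real.log_mul two_ne_zero hm0.ne', neg_le, ← Real.log_inv]
      apply Real.log_le_log (by positivity)
      have : a ∈ Finset.univ.image (fun i => D (i, g b)) :=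
        Finset.mem_image.2 ⟨f a, Finset.mem_univ _, h⟩
      simp only [hq, this, if_true]
      have : 0 < (2 * α)⁻¹ := by positivity
      linarith
    · simp only [h, ne_eq, not_false_eq_true, if_true, one_mul]
      have : -Real.log (q (g b) a) ≤ Real.log 2 + Real.log α := by
        rw [← Real.log_mul two_ne_zero hα0.ne', neg_le, ← Real.log_inv]
        apply Real.log_le_log (by positivity)
        simp only [hq]
        have : 0 < (2 * m)⁻¹ := by positivity
        split_ifs <;> linarith
      linarith
  have h1 : ∀ l, wF1 Q (fun b => if g b = l then 1 else 0) ≤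
      ∑ a, (∑ b, Q (a, b) * (if g b = l then 1 else 0)) * (-Real.log (q l a)) := by
    intro l
    refine wG_gibbs _ (q l) ?_ (hq0 l) (hq1 l)
    intro a
    refine Finset.sum_nonneg fun b _ => mul_nonneg (hQ _) ?_
    beta_reduce
    split_ifs <;> norm_num
  have h2 : ∑ l, ∑ a, (∑ b, Q (a, b) * (if g b = l then 1 else 0)) * (-Real.log (q l a))
      = ∑ a, ∑ b, Q (a, b) * (-Real.log (q (g b) a)) := by
    rw [Finset.sum_comm]
    refine Finset.sum_congr rfl fun a _ => ?_
    simp only [Finset.sum_mul]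
    rw [Finset.sum_comm]
    refine Finset.sum_congr rfl fun b _ => ?_
    rw [Finset.sum_eq_single (g b)]
    · simp
    · intro l _ hl; simp [hl.symm]
    · simp
  have h3 : ∑ a, ∑ b, Q (a, b) * (-Real.log (q (g b) a)) ≤
      ∑ a, ∑ b, (Q (a, b) * (Real.log 2 + Real.log m) +
        (if D (f a, g b) ≠ a then Q (a, b) else 0) * Real.log α) := by
    refine Finset.sum_le_sum fun a _ => Finset.sum_le_sum fun b _ => ?_
    refine (mul_le_mul_of_nonneg_left (hc a b) (hQ _)).trans (le_of_eq ?_)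
    split_ifs <;> ring
  have hQ1' : ∑ a, ∑ b, Q (a, b) = 1 := by
    rw [← hQ1, Finset.sum_comm]; rfl
  simp only [Finset.sum_add_distrib, ← Finset.sum_mul, hQ1', one_mul] at h3
  have h4 := mul_le_mul_of_nonneg_right herr (Real.log_nonneg hα1)
  refine (Finset.sum_le_sum fun l _ => h1 l).trans ?_
  rw [h2]
  linarith

lemma helper_rate {A B L : Type} [Fintype A] [Fintype B] [Fintype L]
    [DecidableEq L] [Nonempty L] (Q : A × B → ℝ) (hQ : ∀ z, 0 ≤ Q z) (hQ1 : ∑ y, wPY Q y = 1)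
    (g : B → L) :
    ∑ l, wF2 Q (fun b => if g b = l then 1 else 0) ≤ Real.log (Fintype.card L) := by
  set m : ℝ := (Fintype.card L : ℝ) with hm
  have hm0 : 0 < m := by rw [hm]; exact_mod_cast Fintype.card_pos
  set v : L → ℝ := fun l => ∑ b, wPY Q b * (if g b = l then 1 else 0) with hv
  have hv0 : ∀ l, 0 ≤ v l := fun l => Finset.sum_nonneg fun b _ =>
    mul_nonneg (wPY_nonneg Q hQ b) (by split_ifs <;> norm_num)
  have hv1 : ∑ l, v l = 1 := by
    simp only [hv]
    rw [Finset.sum_comm]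
    simp [hQ1]
  have h1 : ∀ l, wF2 Q (fun b => if g b = l then 1 else 0) = Real.negMulLog (v l) := by
    intro l
    unfold wF2
    rw [sub_eq_self]
    refine Finset.sum_eq_zero fun b _ => ?_
    beta_reduce
    split_ifs <;> simp
  have h2 := wG_gibbs v (fun _ => m⁻¹) hv0 (fun _ => inv_pos.2 hm0)
    (by simp [← hm, hm0.ne'])
  rw [← Finset.sum_mul, hv1, wG, hv1] at h2
  simp only [h1]
  simpa using h2

lemma shEnt_eq {S : Type*} [Fintype S] (p : S → ℝ) :
    shEnt p = (∑ s, Real.negMulLog (p s)) / Real.log 2 := by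
  unfold shEnt Real.negMulLog Real.logb
  rw [Finset.sum_div]
  exact Finset.sum_congr rfl fun s _ => by ring

lemma condEnt_eq {X Y U : Type} [Fintype X] [Fintype Y] [Fintype U] (P : X × Y → ℝ)
    (W : Y → U → ℝ) : condEnt (fun z : X × U => ∑ y, P (z.1, y) * W y z.2)
      = (∑ u, wF1 P (fun y => W y u)) / Real.log 2 := by
  unfold condEnt
  rw [shEnt_eq, shEnt_eq, ← sub_div]
  unfold wF1 wG
  rw [Finset.sum_sub_distrib, Fintype.sum_prod_type, Finset.sum_comm]

lemma mutInfo_eq {X Y U : Type} [Fintype X] [Fintype Y] [Fintype U] (P : X × Y → ℝ)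
    (W : Y → U → ℝ) (hW : ∀ y, ∑ u, W y u = 1) :
    mutInfo (fun z : U × Y => (∑ x, P (x, z.2)) * W z.2 z.1)
      = (∑ u, wF2 P (fun y => W y u)) / Real.log 2 := by
  unfold mutInfo
  rw [shEnt_eq, shEnt_eq, shEnt_eq, ← add_div, ← sub_div]
  congr 1
  change ∑ u, Real.negMulLog (∑ y, wPY P y * W y u) + ∑ y, Real.negMulLog (∑ u, wPY P y * W y u)
    - ∑ z : U × Y, Real.negMulLog (wPY P z.2 * W z.2 z.1) = _
  unfold wF2
  rw [Finset.sum_sub_distrib, Fintype.sum_prod_type, Finset.sum_comm (f := fun u y => _)]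
  simp only [← Finset.mul_sum, hW, mul_one, Real.negMulLog_mul, Finset.sum_add_distrib,
    ← Finset.sum_mul, one_mul]
  rw [Finset.sum_comm (f := fun u y => wPY P y * Real.negMulLog (W y u))]
  simp only [← Finset.mul_sum]
  ring

/-- Converse part of the Wyner–Ahlswede–Körner theorem. -/
theorem wak_converse
    {X Y : Type} [Fintype X] [Fintype Y] [DecidableEq X]
    (P : X × Y → ℝ) (hP0 : ∀ z, 0 ≤ P z) (hP1 : ∑ z, P z = 1)
    (R1 R2 : ℝ)
    (hach : ∀ ε > (0:ℝ), ∀ δ > (0:ℝ), ∃ N : ℕ, ∀ n, N ≤ n →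
      ∃ (M L : Type) (_ : Fintype M) (_ : Fintype L)
        (f : (Fin n → X) → M) (g : (Fin n → Y) → L)
        (D : M × L → (Fin n → X)),
        (Fintype.card M : ℝ) ≤ 2 ^ ((n : ℝ) * (R1 + δ)) ∧
        (Fintype.card L : ℝ) ≤ 2 ^ ((n : ℝ) * (R2 + δ)) ∧
        ∑ xs : Fin n → X, ∑ ys : Fin n → Y,
          (if D (f xs, g ys) ≠ xs then ∏ t, P (xs t, ys t) else 0) ≤ ε) :
    ∃ (U : Type) (_ : Fintype U) (W : Y → U → ℝ),
      (∀ y u, 0 ≤ W y u) ∧ (∀ y, ∑ u, W y u = 1) ∧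
      R1 ≥ condEnt (fun z : X × U => ∑ y, P (z.1, y) * W y z.2) ∧
      R2 ≥ mutInfo (fun z : U × Y => (∑ x, P (x, z.2)) * W z.2 z.1) := by
  classical
  have hne : Nonempty (X × Y) := by
    by_contra h
    rw [not_nonempty_iff] at h
    simp at hP1
  obtain ⟨⟨x0, y0⟩⟩ := hne
  have : Nonempty X := ⟨x0⟩
  have : Nonempty Y := ⟨y0⟩
  have hl2 : 0 < Real.log 2 := Real.log_pos one_lt_two
  obtain ⟨U, iU, W, hW, hW1, h1, h2⟩ := compact_region (wF1 P) (wF2 P) (wF1_cont P) (wF2_cont P)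
    (wF1_smul P) (wF2_smul P) (R1 * Real.log 2) (R2 * Real.log 2) (by
      intro η hη
      set lx := Real.log (Fintype.card X) with hlx
      have hlx0 : 0 ≤ lx := Real.log_natCast_nonneg _
      obtain ⟨N, hN⟩ := hach (η / 3 / (lx + 1)) (by positivity) (η / 3 / Real.log 2) (by positivity)
      obtain ⟨N2, hN2⟩ := exists_nat_gt (Real.log 2 / (η / 3))
      set n := max N (max N2 1) with hn
      obtain ⟨M, L, _, _, f, g, D, hM, hL, herr⟩ := hN n (le_max_left _ _)
      have hn1 : 1 ≤ n := (le_max_right N2 1).trans (le_max_right _ _)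
      have hnpos : (0:ℝ) < n := by exact_mod_cast hn1
      have hnN2 : (N2 : ℝ) ≤ n := by exact_mod_cast (le_max_left N2 1).trans (le_max_right _ _)
      have hlog2n : Real.log 2 ≤ n * (η / 3) := by
        rw [← div_le_iff₀ (by positivity)]; linarith
      have : Nonempty M := ⟨f fun _ => x0⟩
      have : Nonempty L := ⟨g fun _ => y0⟩
      have hlogc : ∀ (c : ℕ) (R : ℝ), 0 < c → (c : ℝ) ≤ 2 ^ ((n : ℝ) * (R + η / 3 / Real.log 2)) →
          Real.log c ≤ n * (R * Real.log 2 + η / 3) := by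
        intro c R hc h
        have := Real.log_le_log (by exact_mod_cast hc) h
        rw [Real.log_rpow two_pos] at this
        refine this.trans (le_of_eq ?_)
        field_simp
      have hM' := hlogc _ _ Fintype.card_pos hM
      have hL' := hlogc _ _ Fintype.card_pos hL
      have hF := fano (wPn P n) (wPn_nonneg P hP0 n) (wPYn_sum P hP1 n) f g D _ herr
      have hG := helper_rate (wPn P n) (wPn_nonneg P hP0 n) (wPYn_sum P hP1 n) g
      have hcardA : Real.log (Fintype.card (Fin n → X)) = n * lx := by
        rw [Fintype.card_fun, Fintype.card_fin]; push_cast; rw [Real.log_pow]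
      rw [hcardA] at hF
      obtain ⟨U, iU, V, hV, hV1, h1, h2⟩ := single_letter P hP0 hP1 n L
        (fun b l => if g b = l then 1 else 0) (fun b l => by split_ifs <;> norm_num)
        (fun b => by simp)
      have hε : η / 3 / (lx + 1) * (n * lx) ≤ n * (η / 3) := by
        have : η / 3 / (lx + 1) * lx ≤ η / 3 := by
          rw [div_mul_eq_mul_div, div_le_iff₀ (by positivity)]
          nlinarith
        nlinarith
      refine ⟨U, iU, fun y u => (n:ℝ)⁻¹ * V y u, ?_, ?_, ?_, ?_⟩
      · intro y u; exact mul_nonneg (inv_nonneg.2 hnpos.le) (hV y u)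
      · intro y; rw [← Finset.mul_sum, hV1]; exact inv_mul_cancel₀ hnpos.ne'
      · simp only [wF1_smul, ← Finset.mul_sum]
        rw [inv_mul_le_iff₀ hnpos]
        refine (h1.trans hF).trans ?_
        linarith
      · simp only [wF2_smul, ← Finset.mul_sum]
        rw [inv_mul_le_iff₀ hnpos]
        refine (h2.trans hG).trans (hL'.trans ?_)
        apply mul_le_mul_of_nonneg_left _ hnpos.le
        linarith)
  refine ⟨U, iU, W, hW, hW1, ?_, ?_⟩
  · rw [condEnt_eq, ge_iff_le, div_le_iff₀ hl2]; exact h1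
  · rw [mutInfo_eq P W hW1, ge_iff_le, div_le_iff₀ hl2]; exact h2
end
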